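/- arXiv:2502.14165 — 6 statements merged into one kernel-verified Lean document; each statement's English description precedes it below -/
import Mathlib

section
/- Let n ≥ 1, 0 ≤ k ≤ n, and let C ⊆ F₂^{2n} be a linear subspace of dimension n−k that is q-isotropic, i.e. q(x,y) = 0 for all x, y ∈ C, where q(x,y) = wt(x)·wt(y) + x·y modulo 2. Let S be a basis of C and c : S → {+1, −1} any choice of signs. Then P = 2^{−(n−k)} ∏_{x ∈ S} (I + c(x) Γ_x) (the factors commute, so the order of the product is irrelevant) is an orthogonal projection on (ℂ²)^{⊗n} with tr(P) = 2^k, and for every y ∈ F₂^{2n} such that y ∈ C or q(y,z) = 1 for some z ∈ C, there exists ε ∈ ℂ with P Γ_y P = ε P; moreover ε = 0 whenever q(y,z) = 1 for some z ∈ C. -/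
noncomputable section

open Matrix

/-- The Pauli matrix `σ_x`. -/
def pauliX : Matrix (Fin 2) (Fin 2) ℂ := !![0, 1; 1, 0]

/-- The Pauli matrix `σ_y`. -/
def pauliY : Matrix (Fin 2) (Fin 2) ℂ := !![0, -Complex.I; Complex.I, 0]

/-- The Pauli matrix `σ_z`. -/
def pauliZ : Matrix (Fin 2) (Fin 2) ℂ := !![1, 0; 0, -1]

/-- The single-site factor of the `k`-th Weyl–Brauer matrix (with `k` 1-based and
site `i` 0-based): for `1 ≤ k ≤ n` it is `σ_z` on sites before site `k`, `σ_x` at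
site `k`, and the identity afterwards; for `n+1 ≤ k ≤ 2n` the same with `σ_y` at site
`k - n`; and for `k = 2n+1` it is `σ_z` everywhere. -/
def wbFactor (n k i : ℕ) : Matrix (Fin 2) (Fin 2) ℂ :=
  if k ≤ n then (if i + 1 < k then pauliZ else if i + 1 = k then pauliX else 1)
  else if k ≤ 2 * n then
    (if i + 1 < k - n then pauliZ else if i + 1 = k - n then pauliY else 1)
  else pauliZ

/-- The `k`-th Weyl–Brauer matrix on `(ℂ²)^{⊗n}` (with `k` 1-based, `1 ≤ k ≤ 2n+1`),
realized as a matrix indexed by `Fin n → Fin 2`: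
`U_k = σ_z^{⊗(k−1)} ⊗ σ_x ⊗ I₂^{⊗(n−k)}`, `U_{n+k} = σ_z^{⊗(k−1)} ⊗ σ_y ⊗ I₂^{⊗(n−k)}`
for `1 ≤ k ≤ n`, and `U_{2n+1} = σ_z^{⊗n}`. -/
def weylBrauer (n k : ℕ) : Matrix (Fin n → Fin 2) (Fin n → Fin 2) ℂ :=
  Matrix.of fun a b => ∏ i : Fin n, wbFactor n k (i : ℕ) (a i) (b i)

/-- The Hamming weight of a binary vector: the number of nonzero components. -/
def wtZ {l : ℕ} (x : Fin l → ZMod 2) : ℕ :=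
  (Finset.filter (fun i => x i ≠ 0) Finset.univ).card

/-- `τ(x) = wt(x)(wt(x) − 1)/2`. -/
def tauZ {l : ℕ} (x : Fin l → ZMod 2) : ℕ := wtZ x * (wtZ x - 1) / 2

/-- The `k`-th (0-based) component of `x` as a natural number (`0` or `1`), with the
convention that it is `0` out of range. -/
def xcomp {l : ℕ} (x : Fin l → ZMod 2) (k : ℕ) : ℕ :=
  if h : k < l then (x ⟨k, h⟩).val else 0

/-- The Clifford operator `Γ_x` on `(ℂ²)^{⊗n}` for `x ∈ F₂^l`, intended for `l = 2n`
(even case) or `l = 2n+1` (odd case):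
`Γ_x = i^{τ(x)} (∏_{k=1}^{n} U_k^{x_k} U_{n+k}^{x_{n+k}}) U_{2n+1}^{x_{2n+1}}`,
the product taken over `k` in increasing order, where the final factor
`U_{2n+1}^{x_{2n+1}}` is `1` when `l = 2n`. -/
def gammaOp (n l : ℕ) (x : Fin l → ZMod 2) : Matrix (Fin n → Fin 2) (Fin n → Fin 2) ℂ :=
  (Complex.I ^ tauZ x) •
    ((((List.finRange n).map fun k =>
        weylBrauer n ((k : ℕ) + 1) ^ xcomp x (k : ℕ) *
          weylBrauer n (n + (k : ℕ) + 1) ^ xcomp x (n + (k : ℕ))).prod) *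
      weylBrauer n (2 * n + 1) ^ xcomp x (2 * n))

/-- `q(x, y) = wt(x)·wt(y) + x·y` as a natural number (only its parity matters). -/
def qNat {l : ℕ} (x y : Fin l → ZMod 2) : ℕ :=
  wtZ x * wtZ y + (Finset.filter (fun i => x i = 1 ∧ y i = 1) Finset.univ).card

/-- `q(x, y) = wt(x)·wt(y) + x·y` taken modulo 2. -/
def qZ {l : ℕ} (x y : Fin l → ZMod 2) : ZMod 2 := (qNat x y : ZMod 2)

/-! ### Tensor products of single-site matrices -/

def tens {n : ℕ} (A : Fin n → Matrix (Fin 2) (Fin 2) ℂ) :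
    Matrix (Fin n → Fin 2) (Fin n → Fin 2) ℂ :=
  Matrix.of fun a b => ∏ i : Fin n, A i (a i) (b i)

lemma tens_mul {n : ℕ} (A B : Fin n → Matrix (Fin 2) (Fin 2) ℂ) :
    tens A * tens B = tens (fun i => A i * B i) := by
  ext a b
  simp only [tens, Matrix.mul_apply, Matrix.of_apply]
  rw [Finset.prod_univ_sum]
  simp [Finset.prod_mul_distrib]

lemma tens_one {n : ℕ} : tens (fun _ : Fin n => (1 : Matrix (Fin 2) (Fin 2) ℂ)) = 1 := by
  ext a b
  simp only [tens, Matrix.of_apply, Matrix.one_apply]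
  rw [Finset.prod_ite_zero]
  simp [funext_iff]

lemma tens_conj {n : ℕ} (A : Fin n → Matrix (Fin 2) (Fin 2) ℂ) :
    (tens A)ᴴ = tens (fun i => (A i)ᴴ) := by
  ext a b
  simp [tens, Matrix.conjTranspose_apply]

lemma tens_smul {n : ℕ} (s : Fin n → ℂ) (A : Fin n → Matrix (Fin 2) (Fin 2) ℂ) :
    tens (fun i => s i • A i) = (∏ i, s i) • tens A := by
  ext a b
  simp [tens, Finset.prod_mul_distrib]

lemma pX_sq : pauliX * pauliX = 1 := by
  ext i j; fin_cases i <;> fin_cases j <;> simp [pauliX]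
lemma pY_sq : pauliY * pauliY = 1 := by
  ext i j; fin_cases i <;> fin_cases j <;> simp [pauliY]
lemma pZ_sq : pauliZ * pauliZ = 1 := by
  ext i j; fin_cases i <;> fin_cases j <;> simp [pauliZ]
lemma pX_H : pauliXᴴ = pauliX := by
  ext i j; fin_cases i <;> fin_cases j <;> simp [pauliX]
lemma pY_H : pauliYᴴ = pauliY := by
  ext i j; fin_cases i <;> fin_cases j <;> simp [pauliY]
lemma pZ_H : pauliZᴴ = pauliZ := by
  ext i j; fin_cases i <;> fin_cases j <;> simp [pauliZ]
lemma pXY : pauliX * pauliY = -(pauliY * pauliX) := by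
  ext i j; fin_cases i <;> fin_cases j <;> simp [pauliX, pauliY]
lemma pXZ : pauliX * pauliZ = -(pauliZ * pauliX) := by
  ext i j; fin_cases i <;> fin_cases j <;> simp [pauliX, pauliZ]
lemma pYZ : pauliY * pauliZ = -(pauliZ * pauliY) := by
  ext i j; fin_cases i <;> fin_cases j <;> simp [pauliY, pauliZ]

/-- generator number `j`, zero-based -/
def gen (n : ℕ) (j : Fin (2 * n)) : Matrix (Fin n → Fin 2) (Fin n → Fin 2) ℂ :=
  weylBrauer n ((j : ℕ) + 1)

def site (n j : ℕ) : ℕ := if j < n then j else j - n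

def typ (n j : ℕ) : Matrix (Fin 2) (Fin 2) ℂ := if j < n then pauliX else pauliY

def fac (n j i : ℕ) : Matrix (Fin 2) (Fin 2) ℂ :=
  if i < site n j then pauliZ else if i = site n j then typ n j else 1

lemma gen_eq (n : ℕ) (j : Fin (2 * n)) : gen n j = tens (fun i : Fin n => fac n j i) := by
  ext a b
  simp only [gen, weylBrauer, tens, Matrix.of_apply]
  refine Finset.prod_congr rfl fun i _ => ?_
  have hj := j.2
  unfold wbFactor fac site typ
  by_cases h : (j : ℕ) < n
  · simp only [h, if_true, Nat.succ_le_of_lt h]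
    split_ifs <;> first | rfl | omega
  · have h1 : ¬ ((j : ℕ) + 1 ≤ n) := by omega
    have h2 : (j : ℕ) + 1 ≤ 2 * n := by omega
    simp only [h, h1, h2, if_true, if_false]
    split_ifs <;> first | rfl | omega

lemma typ_sq (n j : ℕ) : typ n j * typ n j = 1 := by
  unfold typ; split_ifs; exacts [pX_sq, pY_sq]
lemma typ_H (n j : ℕ) : (typ n j)ᴴ = typ n j := by
  unfold typ; split_ifs; exacts [pX_H, pY_H]
lemma typ_Z (n j : ℕ) : typ n j * pauliZ = -(pauliZ * typ n j) := by
  unfold typ; split_ifs; exacts [pXZ, pYZ]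

lemma gen_sq (n : ℕ) (j : Fin (2 * n)) : gen n j * gen n j = 1 := by
  rw [gen_eq, tens_mul, ← tens_one]
  congr 1; funext i
  unfold fac
  split_ifs
  exacts [pZ_sq, typ_sq _ _, one_mul 1]

lemma gen_H (n : ℕ) (j : Fin (2 * n)) : (gen n j)ᴴ = gen n j := by
  rw [gen_eq, tens_conj]
  congr 1; funext i
  unfold fac
  split_ifs
  exacts [pZ_H, typ_H _ _, Matrix.conjTranspose_one]

lemma site_lt (n : ℕ) (j : Fin (2 * n)) : site n j < n := by
  have := j.2
  unfold site; split_ifs <;> omega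

lemma gen_anti (n : ℕ) (j k : Fin (2 * n)) (h : j ≠ k) :
    gen n j * gen n k = -(gen n k * gen n j) := by
  have hj := site_lt n j
  have hk := site_lt n k
  have hjk : (j : ℕ) ≠ k := fun e => h (Fin.ext e)
  set m : Fin n := ⟨min (site n j) (site n k), by omega⟩ with hm
  have key : ∀ i : Fin n, fac n j i * fac n k i
      = (if i = m then (-1 : ℂ) else 1) • (fac n k i * fac n j i) := by
    intro i
    have him : i = m ↔ (i : ℕ) = min (site n j) (site n k) := by
      rw [hm, Fin.ext_iff]
    simp only [him]
    unfold fac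
    rcases lt_trichotomy (site n j) (site n k) with h1 | h1 | h1
    · rw [min_eq_left h1.le]
      rcases lt_trichotomy (i : ℕ) (site n j) with h2 | h2 | h2
      · simp [h2, h2.trans h1, h2.ne]
      · simp [h2, h1, typ_Z]
      · simp [h2.not_gt, h2.ne']
    · rw [h1, min_self]
      rcases lt_trichotomy (i : ℕ) (site n k) with h2 | h2 | h2
      · simp [h2, h2.ne]
      · simp only [h2, lt_irrefl, if_true, if_false]
        have : (j : ℕ) < n ∧ ¬ (k : ℕ) < n ∨ (k : ℕ) < n ∧ ¬ (j : ℕ) < n := by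
          unfold site at h1
          split_ifs at h1 <;> omega
        rcases this with ⟨a, b⟩ | ⟨a, b⟩
        · simp [typ, a, b, pXY]
        · simp [typ, a, b, pXY]
      · simp [h2.not_gt, h2.ne']
    · rw [min_eq_right h1.le]
      rcases lt_trichotomy (i : ℕ) (site n k) with h2 | h2 | h2
      · simp [h2, h2.trans h1, h2.ne]
      · simp [h2, h1, typ_Z]
      · simp [h2.not_gt, h2.ne']
  rw [gen_eq, gen_eq, tens_mul, tens_mul]
  simp only [key]
  rw [tens_smul]
  simp

/-! ### Ordered monomials -/

section mono
set_option linter.unusedSectionVars false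
variable {ι J : Type} [Fintype ι] [DecidableEq ι] [DecidableEq J]

def mon (V : J → Matrix ι ι ℂ) (x : J → ZMod 2) (l : List J) : Matrix ι ι ℂ :=
  (l.map fun j => V j ^ (x j).val).prod

def sg (x : J → ZMod 2) (j : J) (l : List J) : ℂ :=
  (l.map fun i => if x i ≠ 0 ∧ i ≠ j then (-1 : ℂ) else 1).prod

lemma z2 (a : ZMod 2) : a = 0 ∨ a = 1 := by revert a; decide

lemma mon_cons (V : J → Matrix ι ι ℂ) (x : J → ZMod 2) (j : J) (l : List J) :
    mon V x (j :: l) = V j ^ (x j).val * mon V x l := by simp [mon]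

lemma sg_cons (x : J → ZMod 2) (j i : J) (l : List J) :
    sg x j (i :: l) = (if x i ≠ 0 ∧ i ≠ j then (-1 : ℂ) else 1) * sg x j l := by simp [sg]

lemma sg_sq (x : J → ZMod 2) (j : J) (l : List J) : sg x j l * sg x j l = 1 := by
  induction l with
  | nil => simp [sg]
  | cons i l ih =>
    rw [sg_cons, mul_mul_mul_comm, ih]
    split_ifs <;> simp

lemma V_mon (V : J → Matrix ι ι ℂ) (ha : ∀ i j, i ≠ j → V i * V j = -(V j * V i))
    (x : J → ZMod 2) (j : J) (l : List J) :
    V j * mon V x l = sg x j l • (mon V x l * V j) := by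
  induction l with
  | nil => simp [mon, sg]
  | cons i l ih =>
    have h1 : V j * V i ^ (x i).val
        = (if x i ≠ 0 ∧ i ≠ j then (-1 : ℂ) else 1) • (V i ^ (x i).val * V j) := by
      rcases z2 (x i) with h | h
      · simp [h]
      · by_cases hij : i = j
        · subst hij; simp [h, ZMod.val_one]
        · simp [h, hij, ZMod.val_one, ha j i (Ne.symm hij)]
    rw [mon_cons, sg_cons, ← mul_assoc, h1, smul_mul_assoc, mul_assoc, ih, mul_smul_comm,
      smul_smul, mul_assoc]

lemma Vpow_mon (V : J → Matrix ι ι ℂ) (ha : ∀ i j, i ≠ j → V i * V j = -(V j * V i))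
    (x : J → ZMod 2) (j : J) (a : ZMod 2) (l : List J) :
    V j ^ a.val * mon V x l = (if a ≠ 0 then sg x j l else 1) • (mon V x l * V j ^ a.val) := by
  rcases z2 a with h | h
  · simp [h]
  · simp [h, ZMod.val_one, V_mon V ha]

lemma mon_comm (V : J → Matrix ι ι ℂ) (ha : ∀ i j, i ≠ j → V i * V j = -(V j * V i))
    (x y : J → ZMod 2) (l l' : List J) :
    mon V x l * mon V y l' = (l.map fun j => if x j ≠ 0 then sg y j l' else 1).prod •
      (mon V y l' * mon V x l) := by
  induction l with
  | nil => simp [mon]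
  | cons j l ih =>
    rw [mon_cons, mul_assoc, ih, mul_smul_comm, ← mul_assoc, Vpow_mon V ha, smul_mul_assoc,
      smul_smul, List.map_cons, List.prod_cons, mul_assoc, mul_comm (List.prod _)]

lemma mon_mul (V : J → Matrix ι ι ℂ) (hs : ∀ i, V i * V i = 1)
    (ha : ∀ i j, i ≠ j → V i * V j = -(V j * V i))
    (x y : J → ZMod 2) (l : List J) :
    ∃ s : ℂ, s ≠ 0 ∧ mon V (x + y) l = s • (mon V x l * mon V y l) := by
  induction l with
  | nil => exact ⟨1, one_ne_zero, by simp [mon]⟩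
  | cons j l ih =>
    obtain ⟨s, hs0, h⟩ := ih
    have h1 : V j ^ ((x + y) j).val = V j ^ (x j).val * V j ^ (y j).val := by
      rw [Pi.add_apply]
      rcases z2 (x j) with h | h <;> rcases z2 (y j) with h' | h'
      · simp [h, h']
      · simp [h, h']
      · simp [h, h']
      · have : (1 + 1 : ZMod 2) = 0 := by decide
        simp [h, h', this, ZMod.val_one, hs]
    have h2 := Vpow_mon V ha x j (y j) l
    set t : ℂ := (if y j ≠ 0 then sg x j l else 1) with ht
    have ht0 : t ≠ 0 := by
      rw [ht]; split_ifs
      · intro h0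
        have := sg_sq x j l
        rw [h0] at this; simp at this
      · exact one_ne_zero
    refine ⟨s * t, mul_ne_zero hs0 ht0, ?_⟩
    rw [mon_cons, mon_cons, mon_cons, h1, h, mul_smul_comm, mul_smul]
    congr 1
    rw [mul_assoc, ← mul_assoc _ (mon V x l), h2, smul_mul_assoc, mul_smul_comm]
    simp only [mul_assoc]

lemma mon_star_mul (V : J → Matrix ι ι ℂ) (hs : ∀ i, V i * V i = 1) (hH : ∀ i, (V i)ᴴ = V i)
    (x : J → ZMod 2) (l : List J) : (mon V x l)ᴴ * mon V x l = 1 := by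
  induction l with
  | nil => simp [mon]
  | cons j l ih =>
    have h1 : V j ^ (x j).val * V j ^ (x j).val = 1 := by
      rcases z2 (x j) with h | h <;> simp [h, ZMod.val_one, hs]
    rw [mon_cons, Matrix.conjTranspose_mul, Matrix.conjTranspose_pow, hH, mul_assoc,
      ← mul_assoc (V j ^ _), h1, one_mul, ih]

lemma sg_notMem (x : J → ZMod 2) (j : J) (l : List J) (h : j ∉ l) :
    sg x j l = (-1) ^ (l.countP fun i => x i ≠ 0) := by
  induction l with
  | nil => simp [sg]
  | cons i l ih =>
    simp only [List.mem_cons, not_or] at h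
    rw [sg_cons, ih h.2, List.countP_cons]
    have := Ne.symm h.1
    by_cases hx : x i = 0
    · simp [hx]
    · simp [hx, this, pow_succ]

lemma mon_H (V : J → Matrix ι ι ℂ) (hH : ∀ i, (V i)ᴴ = V i)
    (ha : ∀ i j, i ≠ j → V i * V j = -(V j * V i))
    (x : J → ZMod 2) (l : List J) (hl : l.Nodup) :
    (mon V x l)ᴴ = (-1 : ℂ) ^ ((l.countP fun i => x i ≠ 0).choose 2) • mon V x l := by
  induction l with
  | nil => simp [mon]
  | cons j l ih =>
    rw [List.nodup_cons] at hl
    rw [mon_cons, Matrix.conjTranspose_mul, Matrix.conjTranspose_pow, hH, ih hl.2,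
      Vpow_mon V ha, List.countP_cons, smul_mul_assoc, smul_smul]
    congr 1
    by_cases hx : x j = 0
    · simp [hx]
    · rw [sg_notMem x j l hl.1]
      generalize (l.countP fun i => x i ≠ 0) = w
      have h1 : (if decide (x j ≠ 0) = true then 1 else 0) = 1 := by simp [hx]
      rw [h1, if_pos hx, Nat.choose_succ_succ' _ 1, Nat.choose_one_right, pow_add, mul_right_comm,
        ← mul_pow]
      simp

end mono

/-! ### The Clifford operators -/

def ord (n : ℕ) : List (Fin (2 * n)) :=
  (List.finRange n).flatMap fun k : Fin n =>
    [⟨(k : ℕ), by have := k.2; omega⟩, ⟨n + (k : ℕ), by have := k.2; omega⟩]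

lemma ord_nodup (n : ℕ) : (ord n).Nodup := by
  unfold ord
  rw [List.nodup_flatMap]
  constructor
  · intro k _
    have := k.2
    simp [Fin.ext_iff]
    omega
  · refine (List.nodup_finRange n).imp ?_
    intro a b hab
    have ha := a.2
    have hb := b.2
    have : (a : ℕ) ≠ b := fun e => hab (Fin.ext e)
    simp [Function.onFun, Fin.ext_iff]
    omega

lemma mem_ord (n : ℕ) (j : Fin (2 * n)) : j ∈ ord n := by
  have := j.2
  unfold ord
  rw [List.mem_flatMap]
  by_cases h : (j : ℕ) < n
  · exact ⟨⟨j, h⟩, List.mem_finRange _, by simp⟩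
  · refine ⟨⟨j - n, by omega⟩, List.mem_finRange _, ?_⟩
    simp [Fin.ext_iff]
    omega

lemma ord_toFinset (n : ℕ) : (ord n).toFinset = Finset.univ := by
  ext j; simp [mem_ord]

lemma ord_prod (n : ℕ) (f : Fin (2 * n) → ℂ) : ((ord n).map f).prod = ∏ j, f j := by
  rw [← List.prod_toFinset f (ord_nodup n), ord_toFinset]

lemma ord_count (n : ℕ) (x : Fin (2 * n) → ZMod 2) :
    ((ord n).countP fun i => x i ≠ 0) = wtZ x := by
  rw [List.countP_eq_length_filter, ← List.toFinset_card_of_nodup ((ord_nodup n).filter _),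
    List.toFinset_filter, ord_toFinset]
  simp [wtZ]

lemma gamma_eq (n : ℕ) (x : Fin (2 * n) → ZMod 2) :
    gammaOp n (2 * n) x = (Complex.I ^ tauZ x) • mon (gen n) x (ord n) := by
  have h0 : xcomp x (2 * n) = 0 := by simp [xcomp]
  unfold gammaOp
  rw [h0, pow_zero, mul_one]
  congr 1
  unfold ord
  generalize List.finRange n = l
  induction l with
  | nil => simp [mon]
  | cons k l ih =>
    have := k.2
    have h1 : (k : ℕ) < 2 * n := by omega
    have h2 : n + (k : ℕ) < 2 * n := by omega
    simp only [List.bind_eq_flatMap, List.pure_def] at ih ⊢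
    rw [List.flatMap_cons, List.flatMap_cons]
    simp only [List.cons_append, List.nil_append, mon_cons, List.map_cons, List.prod_cons]
    rw [ih]
    simp only [xcomp, h1, h2, dif_pos, gen, mul_assoc]

lemma prod_wt {l : ℕ} (y : Fin l → ZMod 2) (a : ℂ) :
    (∏ i, if y i ≠ 0 then a else 1) = a ^ wtZ y := by
  rw [Finset.prod_ite]; simp [wtZ]

lemma sg_ord (n : ℕ) (y : Fin (2 * n) → ZMod 2) (j : Fin (2 * n)) :
    sg y j (ord n) = (-1) ^ wtZ y * (if y j ≠ 0 then (-1 : ℂ) else 1) := by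
  unfold sg
  rw [ord_prod, ← prod_wt]
  have : ∀ i, (if y i ≠ 0 ∧ i ≠ j then (-1 : ℂ) else 1)
      = (if y i ≠ 0 then (-1 : ℂ) else 1) *
        (if i = j then (if y j ≠ 0 then (-1 : ℂ) else 1) else 1) := by
    intro i
    by_cases h : i = j
    · subst h
      by_cases h' : y i = 0 <;> simp [h']
    · simp [h]
  simp only [this]
  rw [Finset.prod_mul_distrib]
  simp

lemma gamma_comm (n : ℕ) (x y : Fin (2 * n) → ZMod 2) :
    gammaOp n (2 * n) x * gammaOp n (2 * n) y =
      (-1 : ℂ) ^ qNat x y • (gammaOp n (2 * n) y * gammaOp n (2 * n) x) := by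
  simp only [gamma_eq, smul_mul_assoc, mul_smul_comm]
  rw [mon_comm (gen n) (gen_anti n) x y, ord_prod]
  have : (∏ j, if x j ≠ 0 then sg y j (ord n) else 1) = (-1 : ℂ) ^ qNat x y := by
    have h : ∀ j, (if x j ≠ 0 then sg y j (ord n) else 1)
        = (if x j ≠ 0 then (-1 : ℂ) ^ wtZ y else 1) *
          (if x j = 1 ∧ y j = 1 then (-1 : ℂ) else 1) := by
      intro j
      rw [sg_ord]
      rcases z2 (x j) with h | h <;> rcases z2 (y j) with h' | h' <;> simp [h, h']
    simp only [h]
    rw [Finset.prod_mul_distrib, prod_wt, qNat, pow_add, ← pow_mul, mul_comm (wtZ y)]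
    congr 1
    rw [Finset.prod_ite]; simp
  rw [this]
  simp only [smul_smul]
  congr 1
  ring

lemma gamma_H (n : ℕ) (x : Fin (2 * n) → ZMod 2) :
    (gammaOp n (2 * n) x)ᴴ = gammaOp n (2 * n) x := by
  rw [gamma_eq, Matrix.conjTranspose_smul, mon_H (gen n) (gen_H n) (gen_anti n) x _ (ord_nodup n),
    ord_count, smul_smul, tauZ, ← Nat.choose_two_right]
  congr 1
  rw [star_pow, ← mul_pow]
  simp

lemma gamma_sq (n : ℕ) (x : Fin (2 * n) → ZMod 2) :
    gammaOp n (2 * n) x * gammaOp n (2 * n) x = 1 := by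
  nth_rewrite 1 [← gamma_H]
  rw [gamma_eq, Matrix.conjTranspose_smul, smul_mul_assoc, mul_smul_comm,
    mon_star_mul (gen n) (gen_sq n) (gen_H n), smul_smul, star_pow, ← mul_pow]
  simp

lemma gamma_add (n : ℕ) (x y : Fin (2 * n) → ZMod 2) :
    ∃ s : ℂ, gammaOp n (2 * n) (x + y) =
      s • (gammaOp n (2 * n) x * gammaOp n (2 * n) y) := by
  obtain ⟨s, _, h⟩ := mon_mul (gen n) (gen_sq n) (gen_anti n) x y (ord n)
  refine ⟨Complex.I ^ tauZ (x + y) * s * (Complex.I ^ tauZ x)⁻¹ * (Complex.I ^ tauZ y)⁻¹, ?_⟩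
  rw [gamma_eq, gamma_eq, gamma_eq, h]
  simp only [smul_mul_assoc, mul_smul_comm, smul_smul]
  congr 1
  have h1 : Complex.I ^ tauZ x ≠ 0 := pow_ne_zero _ Complex.I_ne_zero
  have h2 : Complex.I ^ tauZ y ≠ 0 := pow_ne_zero _ Complex.I_ne_zero
  field_simp

lemma gamma_mul (n : ℕ) (x y : Fin (2 * n) → ZMod 2) :
    ∃ s : ℂ, gammaOp n (2 * n) x * gammaOp n (2 * n) y = s • gammaOp n (2 * n) (x + y) := by
  obtain ⟨s, _, h⟩ := mon_mul (gen n) (gen_sq n) (gen_anti n) x y (ord n)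
  refine ⟨(Complex.I ^ tauZ (x + y))⁻¹ * s⁻¹ * (Complex.I ^ tauZ x) * (Complex.I ^ tauZ y), ?_⟩
  rw [gamma_eq, gamma_eq, gamma_eq, h]
  simp only [smul_mul_assoc, mul_smul_comm, smul_smul]
  congr 1
  have h1 : Complex.I ^ tauZ (x + y) ≠ 0 := pow_ne_zero _ Complex.I_ne_zero
  field_simp

lemma gamma_zero (n : ℕ) : gammaOp n (2 * n) 0 = 1 := by
  rw [gamma_eq]
  simp [mon, tauZ, wtZ]

lemma gamma_trace (n : ℕ) (x : Fin (2 * n) → ZMod 2) (hx : x ≠ 0) :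
    (gammaOp n (2 * n) x).trace = 0 := by
  have hj : ∃ j, sg x j (ord n) = -1 := by
    simp only [sg_ord]
    rcases Nat.even_or_odd (wtZ x) with h | h
    · obtain ⟨j, hj⟩ := Function.ne_iff.1 hx
      have : x j ≠ 0 := hj
      exact ⟨j, by simp [this, h.neg_one_pow]⟩
    · by_contra! hcon
      have hall : ∀ j, x j ≠ 0 := by
        intro j h0
        exact hcon j (by simp [h0, h.neg_one_pow])
      have : wtZ x = 2 * n := by simp [wtZ, hall]
      rw [this] at h
      exact (Nat.not_odd_iff_even.2 (even_two_mul n)) h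
  obtain ⟨j, hj⟩ := hj
  have h1 := V_mon (gen n) (gen_anti n) x j (ord n)
  rw [hj] at h1
  have h2 : (mon (gen n) x (ord n)).trace = 0 := by
    have h3 : (gen n j * mon (gen n) x (ord n) * gen n j).trace
        = (mon (gen n) x (ord n)).trace := by
      rw [Matrix.trace_mul_comm, ← mul_assoc, gen_sq, one_mul]
    rw [h1, smul_mul_assoc, mul_assoc, gen_sq, mul_one, Matrix.trace_smul, smul_eq_mul] at h3
    linear_combination (-1 / 2) * h3
  rw [gamma_eq, Matrix.trace_smul, h2, smul_zero]

/-! ### The code projection -/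

def prj (n : ℕ) (c : (Fin (2 * n) → ZMod 2) → ℂ) (L : List (Fin (2 * n) → ZMod 2)) :
    Matrix (Fin n → Fin 2) (Fin n → Fin 2) ℂ :=
  (L.map fun x => (1 : Matrix (Fin n → Fin 2) (Fin n → Fin 2) ℂ) +
        c x • gammaOp n (2 * n) x).prod

lemma prj_cons (n : ℕ) (c : (Fin (2 * n) → ZMod 2) → ℂ) (a : Fin (2 * n) → ZMod 2)
    (L : List (Fin (2 * n) → ZMod 2)) :
    prj n c (a :: L) = (1 + c a • gammaOp n (2 * n) a) * prj n c L := by simp [prj]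

lemma gamma_commute (n : ℕ) (x y : Fin (2 * n) → ZMod 2) (h : qZ x y = 0) :
    Commute (gammaOp n (2 * n) x) (gammaOp n (2 * n) y) := by
  have := gamma_comm n x y
  rwa [Even.neg_one_pow ((ZMod.natCast_eq_zero_iff_even).1 h), one_smul] at this

lemma prj_commute (n : ℕ) (c : (Fin (2 * n) → ZMod 2) → ℂ) (x : Fin (2 * n) → ZMod 2)
    (L : List (Fin (2 * n) → ZMod 2)) (h : ∀ y ∈ L, qZ x y = 0) :
    Commute (gammaOp n (2 * n) x) (prj n c L) := by
  unfold prj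
  apply Commute.list_prod_right
  intro A hA
  obtain ⟨y, hy, rfl⟩ := List.mem_map.1 hA
  exact (Commute.one_right _).add_right ((gamma_commute n x y (h y hy)).smul_right _)

lemma fac_commute (n : ℕ) (c : (Fin (2 * n) → ZMod 2) → ℂ) (x : Fin (2 * n) → ZMod 2)
    (L : List (Fin (2 * n) → ZMod 2)) (h : ∀ y ∈ L, qZ x y = 0) :
    Commute (1 + c x • gammaOp n (2 * n) x) (prj n c L) :=
  (Commute.one_left _).add_left ((prj_commute n c x L h).smul_left _)

lemma prj_H (n : ℕ) (c : (Fin (2 * n) → ZMod 2) → ℂ) (hc : ∀ x, c x = 1 ∨ c x = -1)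
    (L : List (Fin (2 * n) → ZMod 2)) (h : ∀ x ∈ L, ∀ y ∈ L, qZ x y = 0) :
    (prj n c L)ᴴ = prj n c L := by
  induction L with
  | nil => simp [prj]
  | cons a L ih =>
    have hs : star (c a) = c a := by rcases hc a with h | h <;> simp [h]
    rw [prj_cons, Matrix.conjTranspose_mul, ih fun x hx y hy =>
      h x (List.mem_cons_of_mem _ hx) y (List.mem_cons_of_mem _ hy),
      Matrix.conjTranspose_add, Matrix.conjTranspose_one, Matrix.conjTranspose_smul, gamma_H, hs]
    exact (fac_commute n c a L fun y hy =>
      h a List.mem_cons_self y (List.mem_cons_of_mem _ hy)).eq.symm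

lemma prj_sq (n : ℕ) (c : (Fin (2 * n) → ZMod 2) → ℂ) (hc : ∀ x, c x = 1 ∨ c x = -1)
    (L : List (Fin (2 * n) → ZMod 2)) (h : ∀ x ∈ L, ∀ y ∈ L, qZ x y = 0) :
    prj n c L * prj n c L = (2 : ℂ) ^ L.length • prj n c L := by
  induction L with
  | nil => simp [prj]
  | cons a L ih =>
    have ih' := ih fun x hx y hy =>
      h x (List.mem_cons_of_mem _ hx) y (List.mem_cons_of_mem _ hy)
    have hcomm := fac_commute n c a L fun y hy =>
      h a List.mem_cons_self y (List.mem_cons_of_mem _ hy)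
    have hF : (1 + c a • gammaOp n (2 * n) a) * (1 + c a • gammaOp n (2 * n) a)
        = (2 : ℂ) • (1 + c a • gammaOp n (2 * n) a) := by
      have hs : c a * c a = 1 := by rcases hc a with h | h <;> simp [h]
      rw [mul_add, add_mul, add_mul, smul_mul_smul_comm, gamma_sq, hs]
      simp only [one_mul, mul_one, one_smul, two_smul]
      abel
    rw [prj_cons, mul_assoc, ← mul_assoc (prj n c L), ← hcomm.eq, mul_assoc, ih', ← mul_assoc, hF]
    rw [List.length_cons, pow_succ, smul_mul_assoc, mul_smul_comm, smul_smul, mul_comm (2 : ℂ)]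

lemma gamma_prj_mem (n : ℕ) (c : (Fin (2 * n) → ZMod 2) → ℂ) (hc : ∀ x, c x = 1 ∨ c x = -1)
    (L : List (Fin (2 * n) → ZMod 2)) (h : ∀ x ∈ L, ∀ y ∈ L, qZ x y = 0)
    (x : Fin (2 * n) → ZMod 2) (hx : x ∈ L) :
    gammaOp n (2 * n) x * prj n c L = c x • prj n c L := by
  induction L with
  | nil => simp at hx
  | cons a L ih =>
    have ih' := ih fun x hx y hy =>
      h x (List.mem_cons_of_mem _ hx) y (List.mem_cons_of_mem _ hy)
    rw [prj_cons]
    rcases List.mem_cons.1 hx with rfl | hx'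
    · rw [← mul_assoc, mul_add, mul_smul_comm, gamma_sq, mul_one, ← smul_mul_assoc]
      have hs : c x * c x = 1 := by rcases hc x with h | h <;> simp [h]
      rw [smul_add, smul_smul, hs, one_smul, add_comm]
    · have : Commute (gammaOp n (2 * n) x) (1 + c a • gammaOp n (2 * n) a) :=
        (Commute.one_right _).add_right
          ((gamma_commute n x a (h x hx a List.mem_cons_self)).smul_right _)
      rw [← mul_assoc, this.eq, mul_assoc, ih' hx', mul_smul_comm]

lemma gamma_prj_span (n : ℕ) (c : (Fin (2 * n) → ZMod 2) → ℂ) (hc : ∀ x, c x = 1 ∨ c x = -1)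
    (L : List (Fin (2 * n) → ZMod 2)) (h : ∀ x ∈ L, ∀ y ∈ L, qZ x y = 0)
    (x : Fin (2 * n) → ZMod 2) (hx : x ∈ Submodule.span (ZMod 2) {x | x ∈ L}) :
    ∃ e : ℂ, gammaOp n (2 * n) x * prj n c L = e • prj n c L := by
  induction hx using Submodule.span_induction with
  | mem x hx => exact ⟨c x, gamma_prj_mem n c hc L h x hx⟩
  | zero => exact ⟨1, by rw [gamma_zero]; simp⟩
  | add x y _ _ hx hy =>
    obtain ⟨e, he⟩ := hx
    obtain ⟨f, hf⟩ := hy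
    obtain ⟨s, hs⟩ := gamma_add n x y
    refine ⟨s * f * e, ?_⟩
    rw [hs, smul_mul_assoc, mul_assoc, hf, mul_smul_comm, he, smul_smul, smul_smul, mul_assoc]
  | smul a x _ hx =>
    rcases z2 a with rfl | rfl
    · exact ⟨1, by rw [zero_smul, gamma_zero]; simp⟩
    · simpa using hx

lemma trace_gamma_prj (n : ℕ) (c : (Fin (2 * n) → ZMod 2) → ℂ)
    (L : List (Fin (2 * n) → ZMod 2)) : ∀ y : Fin (2 * n) → ZMod 2,
    y ∉ Submodule.span (ZMod 2) {x | x ∈ L} →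
    (gammaOp n (2 * n) y * prj n c L).trace = 0 := by
  induction L with
  | nil =>
    intro y hy
    have : y ≠ 0 := fun e => hy (e ▸ Submodule.zero_mem _)
    simpa [prj] using gamma_trace n y this
  | cons a L ih =>
    intro y hy
    have hle : Submodule.span (ZMod 2) {x | x ∈ L} ≤ Submodule.span (ZMod 2) {x | x ∈ a :: L} :=
      Submodule.span_mono fun x hx => List.mem_cons_of_mem _ hx
    have ha : a ∈ Submodule.span (ZMod 2) {x | x ∈ a :: L} :=
      Submodule.subset_span List.mem_cons_self
    obtain ⟨s, hs⟩ := gamma_mul n y a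
    rw [prj_cons, ← mul_assoc, mul_add, mul_one, mul_smul_comm, hs, add_mul, Matrix.trace_add,
      ih y fun h => hy (hle h), smul_mul_assoc, smul_mul_assoc, Matrix.trace_smul,
      Matrix.trace_smul, ih (y + a) fun h => hy (by
        have := Submodule.sub_mem _ (hle h) ha
        simpa using this)]
    simp

lemma trace_prj (n : ℕ) (c : (Fin (2 * n) → ZMod 2) → ℂ)
    (L : List (Fin (2 * n) → ZMod 2))
    (hli : LinearIndependent (ZMod 2) (fun i : Fin L.length => L.get i)) :
    (prj n c L).trace = (2 : ℂ) ^ n := by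
  induction L with
  | nil => simp [prj, Matrix.trace_one]
  | cons a L ih =>
    have hcons : (fun i : Fin (a :: L).length => (a :: L).get i)
        = Fin.cons a (fun i : Fin L.length => L.get i) := by
      funext i
      refine Fin.cases ?_ (fun i => ?_) i <;> rfl
    have h2 := (linearIndependent_finCons (K := ZMod 2) (x := a)
      (v := fun i : Fin L.length => L.get i)).1 (hcons ▸ hli)
    have hr : Set.range (fun i : Fin L.length => L.get i) = {x | x ∈ L} := by
      ext x; simp [List.mem_iff_get]
    rw [hr] at h2
    rw [prj_cons, add_mul, one_mul, Matrix.trace_add, ih h2.1, smul_mul_assoc, Matrix.trace_smul,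
      trace_gamma_prj n c L a h2.2]
    simp

/-- Quantum codes from `q`-isotropic binary subspaces: if `C ⊆ F₂^{2n}` is a
`q`-isotropic subspace of dimension `n − k` with basis given by the list `L` and
`c` is any choice of signs, then `P = 2^{−(n−k)} ∏_{x ∈ L} (I + c(x) Γ_x)` is an
orthogonal projection of trace `2^k`, and `P` detects `Γ_y` whenever `y ∈ C` or
`q(y,z) = 1` for some `z ∈ C`, with detection scalar `0` in the latter case. -/
theorem qIsotropic_code (n k : ℕ) (hn : 1 ≤ n) (hk : k ≤ n)
    (C : Submodule (ZMod 2) (Fin (2 * n) → ZMod 2))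
    (hdim : Module.finrank (ZMod 2) C = n - k)
    (hiso : ∀ x ∈ C, ∀ y ∈ C, qZ x y = 0)
    (L : List (Fin (2 * n) → ZMod 2))
    (hli : LinearIndependent (ZMod 2) (fun i : Fin L.length => L.get i))
    (hspan : Submodule.span (ZMod 2) {x | x ∈ L} = C)
    (c : (Fin (2 * n) → ZMod 2) → ℂ) (hc : ∀ x, c x = 1 ∨ c x = -1)
    (P : Matrix (Fin n → Fin 2) (Fin n → Fin 2) ℂ)
    (hP : P = ((2 : ℂ) ^ (n - k))⁻¹ •
      (L.map fun x => (1 : Matrix (Fin n → Fin 2) (Fin n → Fin 2) ℂ) +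
        c x • gammaOp n (2 * n) x).prod) :
    Pᴴ = P ∧ P * P = P ∧ P.trace = (2 : ℂ) ^ k ∧
    ∀ y : Fin (2 * n) → ZMod 2, (y ∈ C ∨ ∃ z ∈ C, qZ y z = 1) →
      ∃ ε : ℂ, P * gammaOp n (2 * n) y * P = ε • P ∧
        ((∃ z ∈ C, qZ y z = 1) → ε = 0) := by
  have hr : Set.range (fun i : Fin L.length => L.get i) = {x | x ∈ L} := by
    ext x; simp [List.mem_iff_get]
  have hlen : L.length = n - k := by
    have := finrank_span_eq_card hli
    rw [hr, hspan, hdim] at this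
    simpa using this.symm
  have hmem : ∀ x ∈ L, x ∈ C := fun x hx => hspan ▸ Submodule.subset_span hx
  have hq : ∀ x ∈ L, ∀ y ∈ L, qZ x y = 0 := fun x hx y hy => hiso x (hmem x hx) y (hmem y hy)
  have h20 : ((2 : ℂ) ^ (n - k)) ≠ 0 := pow_ne_zero _ two_ne_zero
  change P = ((2 : ℂ) ^ (n - k))⁻¹ • prj n c L at hP
  have hPP : P * P = P := by
    rw [hP, smul_mul_smul_comm, prj_sq n c hc L hq, hlen, smul_smul]
    congr 1
    field_simp
  have hspanP : ∀ z ∈ C, ∃ e : ℂ, gammaOp n (2 * n) z * P = e • P := by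
    intro z hz
    obtain ⟨e, he⟩ := gamma_prj_span n c hc L hq z (hspan ▸ hz)
    exact ⟨e, by rw [hP, mul_smul_comm, he, smul_comm]⟩
  have hanti : ∀ y : Fin (2 * n) → ZMod 2, (∃ z ∈ C, qZ y z = 1) →
      P * gammaOp n (2 * n) y * P = 0 := by
    rintro y ⟨z, hz, hyz⟩
    obtain ⟨e, he⟩ := hspanP z hz
    have hcm : P * gammaOp n (2 * n) z = e • P := by
      rw [← he, hP]
      exact ((prj_commute n c z L fun w hw => hiso z hz w (hmem w hw)).smul_right _).eq.symm
    have hyz' := gamma_comm n y z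
    rw [Odd.neg_one_pow ((ZMod.natCast_eq_one_iff_odd).1 hyz)] at hyz'
    have h1 : e • (P * gammaOp n (2 * n) y * P) = -(e • (P * gammaOp n (2 * n) y * P)) := by
      calc e • (P * gammaOp n (2 * n) y * P)
          = P * (gammaOp n (2 * n) y * gammaOp n (2 * n) z) * P := by
            rw [← mul_assoc, mul_assoc _ (gammaOp n (2 * n) z) P, he, mul_smul_comm]
        _ = -(P * gammaOp n (2 * n) z * gammaOp n (2 * n) y * P) := by
            rw [hyz']; simp [mul_assoc]
        _ = _ := by rw [hcm]; simp
    have h2 : e • (P * gammaOp n (2 * n) y * P) = 0 := by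
      ext a b
      have h3 := congrFun (congrFun h1 a) b
      rw [Matrix.neg_apply] at h3
      exact self_eq_neg.1 h3
    rcases smul_eq_zero.1 h2 with h0 | h0
    · have : P = 0 := by
        rw [← one_mul P, ← gamma_sq n z, mul_assoc, he, h0]; simp
      rw [this]; simp
    · exact h0
  refine ⟨?_, hPP, ?_, ?_⟩
  · rw [hP, Matrix.conjTranspose_smul, prj_H n c hc L hq]
    simp
  · rw [hP, Matrix.trace_smul, trace_prj n c L hli, smul_eq_mul]
    have : (2 : ℂ) ^ n = 2 ^ (n - k) * 2 ^ k := by rw [← pow_add, Nat.sub_add_cancel hk]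
    rw [this]
    field_simp
  · intro y hy
    by_cases hz : ∃ z ∈ C, qZ y z = 1
    · exact ⟨0, by rw [hanti y hz, zero_smul], fun _ => rfl⟩
    · obtain ⟨e, he⟩ := hspanP y (hy.resolve_right hz)
      exact ⟨e, by rw [mul_assoc, he, mul_smul_comm, hPP], fun h => absurd h hz⟩

end
end

section
/- For every integer s ≥ 3, setting n = 2^s − 1, there exists an orthogonal projection P on (ℂ²)^{⊗n} of rank 2^{2^s − s − 2} such that P Γ_x P = 0 for every x ∈ F₂^{2n+1} with 1 ≤ wt(x) ≤ 2. (Equivalently, there exists a pure quantum code of dimension 2^{2^s − s − 2} whose even and odd Clifford minimum distance is at least 3.) -/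
noncomputable section

open Matrix

theorem tensor_mul {n : ℕ} (A B : Fin n → Matrix (Fin 2) (Fin 2) ℂ) :
    (Matrix.of fun a b : Fin n → Fin 2 => ∏ i, A i (a i) (b i)) *
    (Matrix.of fun a b : Fin n → Fin 2 => ∏ i, B i (a i) (b i)) =
    Matrix.of fun a b : Fin n → Fin 2 => ∏ i, (A i * B i) (a i) (b i) := by
  ext a c
  simp only [Matrix.mul_apply, Matrix.of_apply, ← Finset.prod_mul_distrib]
  rw [Finset.prod_univ_sum]
  simp

theorem wb_sq_factor (n k i : ℕ) : wbFactor n k i * wbFactor n k i = 1 := by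
  have hx : pauliX * pauliX = 1 := by
    ext a b; fin_cases a <;> fin_cases b <;> simp [pauliX, Matrix.mul_apply]
  have hy : pauliY * pauliY = 1 := by
    ext a b; fin_cases a <;> fin_cases b <;> simp [pauliY, Matrix.mul_apply]
  have hz : pauliZ * pauliZ = 1 := by
    ext a b; fin_cases a <;> fin_cases b <;> simp [pauliZ, Matrix.mul_apply]
  unfold wbFactor
  split_ifs <;> simp [*]

theorem wb_herm_factor (n k i : ℕ) : (wbFactor n k i)ᴴ = wbFactor n k i := by
  have hx : pauliXᴴ = pauliX := by
    ext a b; fin_cases a <;> fin_cases b <;> simp [pauliX]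
  have hy : pauliYᴴ = pauliY := by
    ext a b; fin_cases a <;> fin_cases b <;> simp [pauliY]
  have hz : pauliZᴴ = pauliZ := by
    ext a b; fin_cases a <;> fin_cases b <;> simp [pauliZ]
  unfold wbFactor
  split_ifs <;> simp [*]

theorem wb_sq (n k : ℕ) : weylBrauer n k * weylBrauer n k = 1 := by
  unfold weylBrauer
  rw [tensor_mul]
  simp only [wb_sq_factor]
  ext a b
  simp only [Matrix.of_apply, Matrix.one_apply, Finset.prod_ite_zero, funext_iff]
  simp

theorem wb_herm (n k : ℕ) : (weylBrauer n k)ᴴ = weylBrauer n k := by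
  ext a b
  simp only [weylBrauer, Matrix.conjTranspose_apply, Matrix.of_apply, star_prod]
  refine Finset.prod_congr rfl fun i _ => ?_
  conv_rhs => rw [← wb_herm_factor]
  rfl

theorem wb_anti_factor (n k l : ℕ) (hk : 1 ≤ k) (hl : 1 ≤ l) (hk' : k ≤ 2 * n + 1)
    (hl' : l ≤ 2 * n + 1) (h : k ≠ l) :
    ∃ q, q < n ∧ ∀ i, i < n → wbFactor n k i * wbFactor n l i =
      (if i = q then (-1 : ℂ) else 1) • (wbFactor n l i * wbFactor n k i) := by
  have hxy : pauliX * pauliY = - (pauliY * pauliX) := by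
    ext a b; fin_cases a <;> fin_cases b <;> simp [pauliX, pauliY, Matrix.mul_apply]
  have hxz : pauliX * pauliZ = - (pauliZ * pauliX) := by
    ext a b; fin_cases a <;> fin_cases b <;> simp [pauliX, pauliZ, Matrix.mul_apply]
  have hyz : pauliY * pauliZ = - (pauliZ * pauliY) := by
    ext a b; fin_cases a <;> fin_cases b <;> simp [pauliY, pauliZ, Matrix.mul_apply]
  refine ⟨min (if k ≤ n then k - 1 else if k ≤ 2 * n then k - n - 1 else n)
    (if l ≤ n then l - 1 else if l ≤ 2 * n then l - n - 1 else n), ?_, ?_⟩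
  · split_ifs <;> omega
  · intro i hi
    unfold wbFactor
    split_ifs <;> first | omega | simp [*]

theorem wb_anti (n k l : ℕ) (hk : 1 ≤ k) (hl : 1 ≤ l) (hk' : k ≤ 2 * n + 1)
    (hl' : l ≤ 2 * n + 1) (h : k ≠ l) :
    weylBrauer n k * weylBrauer n l = - (weylBrauer n l * weylBrauer n k) := by
  obtain ⟨q, hq, H⟩ := wb_anti_factor n k l hk hl hk' hl' h
  unfold weylBrauer
  rw [tensor_mul, tensor_mul]
  ext a b
  simp only [Matrix.of_apply, Matrix.neg_apply]
  rw [Finset.prod_congr rfl fun i _ => by rw [H i i.2]]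
  simp only [Matrix.smul_apply, smul_eq_mul, Finset.prod_mul_distrib]
  have : ∏ i : Fin n, (if (i : ℕ) = q then (-1 : ℂ) else 1) = -1 := by
    rw [Finset.prod_eq_single (⟨q, hq⟩ : Fin n)]
    · simp
    · intro i _ hi
      rw [if_neg]
      intro h; apply hi; ext; exact h
    · simp
  rw [this]; ring

/-- product over a list -/
def lprod {A : Type*} [Ring A] (U : ℕ → A) (l : List ℕ) : A := (l.map U).prod

/-- sign for bits -/
def bsgn (b : Bool) : ℂ := if b then -1 else 1

section abs
variable {ι : Type*} [Fintype ι] [DecidableEq ι] (U : ℕ → Matrix ι ι ℂ) (S : ℕ → Prop)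

theorem comm_lprod (hA : ∀ k l, S k → S l → k ≠ l → U k * U l = - (U l * U k))
    (k : ℕ) (hk : S k) (l : List ℕ) (hl : ∀ a ∈ l, S a) (hn : l.Nodup) :
    lprod U l * U k = ((-1 : ℂ) ^ l.length * bsgn (decide (k ∈ l))) • (U k * lprod U l) := by
  induction l with
  | nil => simp [lprod, bsgn]
  | cons a l ih =>
    have ih := ih (fun b hb => hl b (by simp [hb])) (List.nodup_cons.1 hn).2
    have hS := hl a (by simp)
    have hal := (List.nodup_cons.1 hn).1
    have e : lprod U (a :: l) = U a * lprod U l := by simp [lprod]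
    rw [e, mul_assoc, ih, mul_smul_comm, ← mul_assoc, ← mul_assoc]
    by_cases h : k = a
    · subst h
      simp [hal, bsgn, pow_succ]
    · rw [hA a k hS hk (Ne.symm h)]
      simp [h, pow_succ]

theorem herm_lprod (hH : ∀ k, S k → (U k)ᴴ = U k)
    (hA : ∀ k l, S k → S l → k ≠ l → U k * U l = - (U l * U k))
    (l : List ℕ) (hl : ∀ a ∈ l, S a) (hn : l.Nodup) :
    (lprod U l)ᴴ = ((-1 : ℂ) ^ (l.length.choose 2)) • lprod U l := by
  induction l with
  | nil => simp [lprod]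
  | cons a l ih =>
    have hl' : ∀ b ∈ l, S b := fun b hb => hl b (by simp [hb])
    have ih := ih hl' (List.nodup_cons.1 hn).2
    have hS := hl a (by simp)
    have hal := (List.nodup_cons.1 hn).1
    have e : lprod U (a :: l) = U a * lprod U l := by simp [lprod]
    rw [e, Matrix.conjTranspose_mul, ih, hH a hS, smul_mul_assoc,
      comm_lprod U S hA a hS l hl' (List.nodup_cons.1 hn).2, smul_smul]
    congr 1
    rw [List.length_cons, Nat.choose_succ_succ' , Nat.choose_one_right, pow_add]
    simp [hal, bsgn, mul_comm]

theorem unit_lprod (hsq : ∀ k, S k → U k * U k = 1)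
    (hH : ∀ k, S k → (U k)ᴴ = U k)
    (l : List ℕ) (hl : ∀ a ∈ l, S a) :
    (lprod U l)ᴴ * lprod U l = 1 := by
  induction l with
  | nil => simp [lprod]
  | cons a l ih =>
    have hl' : ∀ b ∈ l, S b := fun b hb => hl b (by simp [hb])
    have ih := ih hl'
    have hS := hl a (by simp)
    have e : lprod U (a :: l) = U a * lprod U l := by simp [lprod]
    rw [e, Matrix.conjTranspose_mul, hH a hS, mul_assoc, ← mul_assoc (U a), hsq a hS, one_mul, ih]

/-- the code projection -/
def codeProj (g : ℕ → Matrix ι ι ℂ) : ℕ → Matrix ι ι ℂ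
  | 0 => 1
  | m + 1 => codeProj g m * ((1 / 2 : ℂ) • (1 + g m))

variable (g : ℕ → Matrix ι ι ℂ)

theorem codeProj_comm (m : ℕ) (A : Matrix ι ι ℂ) (h : ∀ i < m, Commute A (g i)) :
    Commute A (codeProj g m) := by
  induction m with
  | zero => exact Commute.one_right _
  | succ m ih =>
    refine (ih fun i hi => h i (by omega)).mul_right ?_
    exact ((Commute.one_right _).add_right (h m (by omega))).smul_right _

theorem half_sq (a : Matrix ι ι ℂ) (h : a * a = 1) :
    ((1 / 2 : ℂ) • (1 + a)) * ((1 / 2 : ℂ) • (1 + a)) = (1 / 2 : ℂ) • (1 + a) := by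
  rw [smul_mul_smul_comm, mul_add, add_mul, add_mul, h]
  simp only [one_mul, mul_one]
  rw [show (1 + a + (a + 1)) = (2 : ℂ) • (1 + a) by rw [two_smul]; abel, smul_smul]
  norm_num

theorem codeProj_spec (m : ℕ) (hg : ∀ i < m, (g i)ᴴ = g i) (hg2 : ∀ i < m, g i * g i = 1)
    (hc : ∀ i < m, ∀ j < m, Commute (g i) (g j)) :
    (codeProj g m)ᴴ = codeProj g m ∧ codeProj g m * codeProj g m = codeProj g m ∧
    ∀ j < m, codeProj g m * g j = codeProj g m := by
  induction m with
  | zero => simp [codeProj]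
  | succ m ih =>
    obtain ⟨h1, h2, h3⟩ := ih (fun i hi => hg i (by omega)) (fun i hi => hg2 i (by omega))
      (fun i hi j hj => hc i (by omega) j (by omega))
    have hcm : Commute (g m) (codeProj g m) :=
      codeProj_comm g m _ fun i hi => hc m (by omega) i (by omega)
    have hch : Commute ((1 / 2 : ℂ) • (1 + g m)) (codeProj g m) :=
      ((Commute.one_left _).add_left hcm).smul_left _
    refine ⟨?_, ?_, ?_⟩
    · rw [codeProj, Matrix.conjTranspose_mul, h1, Matrix.conjTranspose_smul,
        Matrix.conjTranspose_add, hg m (by omega), ← hch.eq]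
      simp
    · rw [codeProj, mul_assoc, ← mul_assoc _ (codeProj g m), hch.eq, mul_assoc,
        half_sq _ (hg2 m (by omega)), ← mul_assoc, h2]
    · intro j hj
      have hcj : Commute (g j) ((1 / 2 : ℂ) • (1 + g m)) :=
        ((Commute.one_right _).add_right (hc j (by omega) m (by omega))).smul_right _
      rw [codeProj, mul_assoc]
      by_cases h : j = m
      · subst h
        rw [smul_mul_assoc, add_mul, hg2 j hj, one_mul, add_comm]
      · rw [← hcj.eq, ← mul_assoc, h3 j (by omega)]

theorem codeProj_trace (m : ℕ) (E : ℕ → Matrix ι ι ℂ) (hE : ∀ i < m, E i * E i = 1)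
    (hEa : ∀ i < m, E i * g i = - (g i * E i))
    (hEc : ∀ i < m, ∀ j < m, i ≠ j → Commute (E i) (g j)) :
    (codeProj g m).trace * 2 ^ m = Fintype.card ι := by
  induction m with
  | zero => simp [codeProj]
  | succ m ih =>
    have ih := ih (fun i hi => hE i (by omega)) (fun i hi => hEa i (by omega))
      (fun i hi j hj => hEc i (by omega) j (by omega))
    have hcm : Commute (E m) (codeProj g m) :=
      codeProj_comm g m _ fun i hi => hEc m (by omega) i (by omega) (by omega)
    have key : (codeProj g m * g m).trace = 0 := by
      have : (codeProj g m * g m).trace = - (codeProj g m * g m).trace := by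
        conv_lhs => rw [← mul_one (codeProj g m * g m), ← hE m (by omega), ← mul_assoc,
          Matrix.trace_mul_comm, ← mul_assoc, ← mul_assoc, hcm.eq, mul_assoc (codeProj g m),
          hEa m (by omega), mul_neg, neg_mul, mul_assoc, mul_assoc, hE m (by omega), mul_one]
        rw [Matrix.trace_neg]
      exact self_eq_neg.1 this
    rw [codeProj, mul_smul_comm, mul_add, mul_one, Matrix.trace_smul, Matrix.trace_add, key,
      ← ih]
    simp [pow_succ]; ring

end abs


theorem count_double (N : ℕ) (p : ℕ → Bool) :
    ((Finset.range (2 * N)).filter fun k => p k).card =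
      ((Finset.range N).filter fun k => p (2 * k)).card +
      ((Finset.range N).filter fun k => p (2 * k + 1)).card := by
  simp only [Finset.card_filter]
  induction N with
  | zero => simp
  | succ N ih =>
    rw [show 2 * (N + 1) = 2 * N + 1 + 1 by ring, Finset.sum_range_succ, Finset.sum_range_succ,
      ih, Finset.sum_range_succ, Finset.sum_range_succ]
    ring

theorem count_bit (m i : ℕ) (h : i < m) :
    ((Finset.range (2 ^ m)).filter fun k => k.testBit i).card = 2 ^ (m - 1) := by
  induction m generalizing i with
  | zero => omega
  | succ m ih =>
    rw [pow_succ', count_double]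
    cases i with
    | zero => simp [Nat.testBit_zero, Nat.add_mod]
    | succ i =>
      have e : ∀ k, (2 * k + 1) / 2 = k := by omega
      obtain ⟨m, rfl⟩ : ∃ m', m = m' + 1 := ⟨m - 1, by omega⟩
      have := ih i (by omega)
      simp [Nat.testBit_succ, e] at this ⊢
      rw [this, pow_succ]; ring

theorem count_bits' (m i j : ℕ) (h : i < j) (h' : j < m) :
    ((Finset.range (2 ^ m)).filter fun k => k.testBit i && k.testBit j).card = 2 ^ (m - 2) := by
  induction m generalizing i j with
  | zero => omega
  | succ m ih =>
    have e : ∀ k, (2 * k + 1) / 2 = k := by omega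
    rw [pow_succ', count_double]
    obtain ⟨j, rfl⟩ : ∃ m', j = m' + 1 := ⟨j - 1, by omega⟩
    cases i with
    | zero =>
      have := count_bit m j (by omega)
      simp [Nat.testBit_zero, Nat.add_mod, Nat.testBit_succ, e] at this ⊢
      rw [this]
    | succ i =>
      obtain ⟨m, rfl⟩ : ∃ m', m = m' + 2 := ⟨m - 2, by omega⟩
      have := ih i j (by omega) (by omega)
      simp [Nat.testBit_succ, e] at this ⊢
      rw [this, pow_succ]; ring

theorem count_bits (m i j : ℕ) (h : i < m) (h' : j < m) (hij : i ≠ j) :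
    ((Finset.range (2 ^ m)).filter fun k => k.testBit i && k.testBit j).card = 2 ^ (m - 2) := by
  rcases lt_or_gt_of_ne hij with h1 | h1
  · exact count_bits' m i j h1 h'
  · rw [← count_bits' m j i h1 h]
    congr 1
    ext k
    simp [and_comm]

/-- commutation up to a scalar -/
def Sc {ι : Type*} [Fintype ι] (g : Matrix ι ι ℂ) (c : ℂ) (A : Matrix ι ι ℂ) : Prop :=
  g * A = c • (A * g)

section sc
variable {ι : Type*} [Fintype ι] [DecidableEq ι] {g : Matrix ι ι ℂ}

theorem Sc.one : Sc g 1 1 := by simp [Sc]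

theorem Sc.mul {c d : ℂ} {A B : Matrix ι ι ℂ} (h : Sc g c A) (h' : Sc g d B) :
    Sc g (c * d) (A * B) := by
  unfold Sc at *
  rw [← mul_assoc, h, smul_mul_assoc, mul_assoc, h', mul_smul_comm, smul_smul, mul_assoc]

theorem Sc.pow {c : ℂ} {A : Matrix ι ι ℂ} (h : Sc g c A) (k : ℕ) : Sc g (c ^ k) (A ^ k) := by
  induction k with
  | zero => simpa using Sc.one
  | succ k ih => rw [pow_succ, pow_succ]; exact ih.mul h

theorem Sc.smul {c : ℂ} {A : Matrix ι ι ℂ} (h : Sc g c A) (d : ℂ) : Sc g c (d • A) := by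
  unfold Sc at *
  rw [mul_smul_comm, h, smul_mul_assoc, smul_comm]

theorem Sc.listProd {α : Type*} (l : List α) (c : α → ℂ) (A : α → Matrix ι ι ℂ)
    (h : ∀ a ∈ l, Sc g (c a) (A a)) : Sc g (l.map c).prod (l.map A).prod := by
  induction l with
  | nil => simpa using Sc.one
  | cons a l ih =>
    simp only [List.map_cons, List.prod_cons]
    exact (h a (by simp)).mul (ih fun b hb => h b (by simp [hb]))

end sc

theorem prod_range_two_mul' (n : ℕ) (f : ℕ → ℂ) :
    ∏ i ∈ Finset.range (2 * n), f i = ((List.range n).map fun k => f k * f (n + k)).prod := by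
  rw [two_mul, Finset.prod_range_add, ← Finset.prod_mul_distrib]
  rfl

theorem gamma_sc (n : ℕ) (g : Matrix (Fin n → Fin 2) (Fin n → Fin 2) ℂ) (c : ℕ → ℂ)
    (h : ∀ k, 1 ≤ k → k ≤ 2 * n + 1 → Sc g (c k) (weylBrauer n k))
    (x : Fin (2 * n + 1) → ZMod 2) :
    Sc g (∏ i ∈ Finset.univ.filter (fun i => x i ≠ 0), c ((i : ℕ) + 1))
      (gammaOp n (2 * n + 1) x) := by
  have hl : (do let a ← List.finRange n; pure (a : ℕ)) = List.range n := by
    simp [List.bind_eq_flatMap, ← List.map_eq_flatMap]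
  have H : Sc g (((List.range n).map fun k : ℕ =>
      c (k + 1) ^ xcomp x k * c (n + k + 1) ^ xcomp x (n + k)).prod *
      c (2 * n + 1) ^ xcomp x (2 * n)) (gammaOp n (2 * n + 1) x) := by
    unfold gammaOp
    rw [hl]
    apply Sc.smul
    apply Sc.mul
    · apply Sc.listProd
      intro k hk
      rw [List.mem_range] at hk
      exact ((h (k + 1) (by omega) (by omega)).pow (xcomp x k)).mul
        ((h (n + k + 1) (by omega) (by omega)).pow (xcomp x (n + k)))
    · exact (h (2 * n + 1) (by omega) (by omega)).pow (xcomp x (2 * n))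
  convert H using 1
  have e : ∀ i : Fin (2 * n + 1), (if x i ≠ 0 then c ((i : ℕ) + 1) else 1) =
      c ((i : ℕ) + 1) ^ xcomp x (i : ℕ) := by
    intro i
    simp only [xcomp, i.2, dif_pos]
    have : ∀ y : ZMod 2, (if y ≠ 0 then c ((i : ℕ) + 1) else 1) = c ((i : ℕ) + 1) ^ y.val := by
      intro y
      by_cases hy : y = 0
      · simp [hy]
      · have hy1 : y.val = 1 := by
          revert hy; revert y; decide
        simp [hy, hy1]
    exact this _
  rw [Finset.prod_filter, Finset.prod_congr rfl fun i _ => e i,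
    Fin.prod_univ_eq_prod_range (fun i => c (i + 1) ^ xcomp x i), Finset.prod_range_succ,
    prod_range_two_mul' n (fun i => c (i + 1) ^ xcomp x i)]

theorem exists_bit (n m : ℕ) (hm : 2 * n + 1 < 2 ^ m) (x : Fin (2 * n + 1) → ZMod 2)
    (h1 : 1 ≤ wtZ x) (h2 : wtZ x ≤ 2) :
    ∃ j < m, ∏ i ∈ Finset.univ.filter (fun i => x i ≠ 0),
      bsgn (((i : ℕ) + 1).testBit j) = -1 := by
  have key : ∀ a b : ℕ, a < 2 ^ m → b < 2 ^ m → a ≠ b →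
      ∃ j < m, a.testBit j ≠ b.testBit j := by
    intro a b ha hb hab
    by_contra! hcon
    apply hab
    apply Nat.eq_of_testBit_eq
    intro j
    by_cases hj : j < m
    · exact hcon j hj
    · have : 2 ^ m ≤ 2 ^ j := Nat.pow_le_pow_right (by norm_num) (by omega)
      rw [Nat.testBit_lt_two_pow (by omega), Nat.testBit_lt_two_pow (by omega)]
  have hc : wtZ x = 1 ∨ wtZ x = 2 := by omega
  unfold wtZ at hc
  rcases hc with hc | hc
  · obtain ⟨a, ha⟩ := Finset.card_eq_one.1 hc
    obtain ⟨j, hj, hne⟩ := key (a + 1) 0 (by omega) (by positivity) (by omega)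
    refine ⟨j, hj, ?_⟩
    rw [ha, Finset.prod_singleton]
    simp at hne
    simp [bsgn, hne]
  · obtain ⟨a, b, hab, ha⟩ := Finset.card_eq_two.1 hc
    obtain ⟨j, hj, hne⟩ := key (a + 1) (b + 1) (by omega) (by omega)
      (by intro h; apply hab; ext; omega)
    refine ⟨j, hj, ?_⟩
    rw [ha, Finset.prod_pair hab]
    cases h : Nat.testBit (a + 1) j <;> cases h' : Nat.testBit (b + 1) j <;> simp_all [bsgn]

theorem rank_of_proj {ι : Type*} [Fintype ι] [DecidableEq ι] (P : Matrix ι ι ℂ)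
    (h : P * P = P) : (P.rank : ℂ) = P.trace := by
  have hi : IsIdempotentElem (Matrix.toLin' P) := by
    unfold IsIdempotentElem
    rw [Module.End.mul_eq_comp, ← Matrix.toLin'_mul, h]
  have := (LinearMap.IsIdempotentElem.isProj_range _ hi).trace
  rw [Matrix.trace_toLin'_eq] at this
  rw [Matrix.toLin'_apply'] at this
  rw [this, Matrix.rank]


/-- indices with bit `j` set -/
def bitSet (m j : ℕ) : Finset ℕ := (Finset.range (2 ^ m)).filter fun k => k.testBit j

/-- the stabilizer generators -/
def stab (n m j : ℕ) : Matrix (Fin n → Fin 2) (Fin n → Fin 2) ℂ :=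
  lprod (weylBrauer n) (bitSet m j).toList

theorem bitSet_mem (n m j : ℕ) (hm : 2 * n + 2 = 2 ^ m) :
    ∀ a ∈ (bitSet m j).toList, 1 ≤ a ∧ a ≤ 2 * n + 1 := by
  intro a ha
  rw [Finset.mem_toList, bitSet, Finset.mem_filter, Finset.mem_range] at ha
  have : a ≠ 0 := by
    rintro rfl
    simp at ha
  omega

theorem wb_anti' (n : ℕ) (k l : ℕ) (hk : 1 ≤ k ∧ k ≤ 2 * n + 1) (hl : 1 ≤ l ∧ l ≤ 2 * n + 1)
    (h : k ≠ l) : weylBrauer n k * weylBrauer n l = - (weylBrauer n l * weylBrauer n k) :=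
  wb_anti n k l hk.1 hl.1 hk.2 hl.2 h

theorem stab_sc (n m j : ℕ) (hm : 2 * n + 2 = 2 ^ m) (h4 : 4 ≤ m) (hj : j < m) (k : ℕ)
    (hk : 1 ≤ k ∧ k ≤ 2 * n + 1) : Sc (stab n m j) (bsgn (k.testBit j)) (weylBrauer n k) := by
  have := comm_lprod (weylBrauer n) (fun k => 1 ≤ k ∧ k ≤ 2 * n + 1) (wb_anti' n) k hk
    (bitSet m j).toList (bitSet_mem n m j hm) (Finset.nodup_toList _)
  unfold Sc stab
  rw [this]
  congr 1
  have hkm : k < 2 ^ m := by omega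
  have hmem : decide (k ∈ (bitSet m j).toList) = k.testBit j := by
    simp [bitSet, hkm]
  rw [hmem, Finset.length_toList, bitSet, count_bit m j hj, Even.neg_one_pow, one_mul]
  exact (even_two).pow_of_ne_zero (by omega)

theorem stab_herm (n m j : ℕ) (hm : 2 * n + 2 = 2 ^ m) (h4 : 4 ≤ m) (hj : j < m) :
    (stab n m j)ᴴ = stab n m j := by
  have := herm_lprod (weylBrauer n) (fun k => 1 ≤ k ∧ k ≤ 2 * n + 1)
    (fun k _ => wb_herm n k) (wb_anti' n)
    (bitSet m j).toList (bitSet_mem n m j hm) (Finset.nodup_toList _)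
  unfold stab
  rw [this, Finset.length_toList, bitSet, count_bit m j hj, Even.neg_one_pow, one_smul]
  obtain ⟨r, rfl⟩ : ∃ r, m = r + 3 := ⟨m - 3, by omega⟩
  rw [Nat.choose_two_right, show r + 3 - 1 = r + 2 by omega,
    show 2 ^ (r + 2) = 2 * (2 * 2 ^ r) by ring, mul_assoc, Nat.mul_div_cancel_left _ (by norm_num),
    mul_assoc]
  exact even_two_mul _

theorem stab_sq (n m j : ℕ) (hm : 2 * n + 2 = 2 ^ m) (h4 : 4 ≤ m) (hj : j < m) :
    stab n m j * stab n m j = 1 := by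
  have := unit_lprod (weylBrauer n) (fun k => 1 ≤ k ∧ k ≤ 2 * n + 1)
    (fun k _ => wb_sq n k) (fun k _ => wb_herm n k)
    (bitSet m j).toList (bitSet_mem n m j hm)
  change (stab n m j)ᴴ * stab n m j = 1 at this
  rwa [stab_herm n m j hm h4 hj] at this

theorem stab_comm (n m i j : ℕ) (hm : 2 * n + 2 = 2 ^ m) (h4 : 4 ≤ m) (hi : i < m) (hj : j < m) :
    Commute (stab n m i) (stab n m j) := by
  by_cases hij : i = j
  · subst hij; exact Commute.refl _
  have := Sc.listProd (g := stab n m i) (bitSet m j).toList (fun k => bsgn (k.testBit i))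
    (weylBrauer n) (fun a ha => stab_sc n m i hm h4 hi a (bitSet_mem n m j hm a ha))
  rw [Finset.prod_map_toList] at this
  have e : ∏ k ∈ bitSet m j, bsgn (k.testBit i) = 1 := by
    unfold bsgn
    rw [Finset.prod_ite, Finset.prod_const, Finset.prod_const_one, mul_one, bitSet,
      Finset.filter_filter]
    have := count_bits m j i hj hi (Ne.symm hij)
    simp only [Bool.and_eq_true] at this
    rw [this, Even.neg_one_pow]
    exact (even_two).pow_of_ne_zero (by omega)
  rw [e] at this
  unfold Sc at this
  rw [one_smul] at this
  exact this

theorem main_aux (n m : ℕ) (hm : 2 * n + 2 = 2 ^ m) (h4 : 4 ≤ m) (hmn : m ≤ n) :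
    ∃ P : Matrix (Fin n → Fin 2) (Fin n → Fin 2) ℂ,
      Pᴴ = P ∧ P * P = P ∧ P.rank = 2 ^ (n - m) ∧
      ∀ x : Fin (2 * n + 1) → ZMod 2, 1 ≤ wtZ x → wtZ x ≤ 2 →
        P * gammaOp n (2 * n + 1) x * P = 0 := by
  obtain ⟨h1, h2, h3⟩ := codeProj_spec (stab n m) m (fun i hi => stab_herm n m i hm h4 hi)
    (fun i hi => stab_sq n m i hm h4 hi) (fun i hi j hj => stab_comm n m i j hm h4 hi hj)
  have hpow : ∀ i < m, 1 ≤ 2 ^ i ∧ 2 ^ i ≤ 2 * n + 1 := by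
    intro i hi
    have := Nat.pow_lt_pow_right (a := 2) (by norm_num) hi
    have := Nat.one_le_two_pow (n := i)
    omega
  have htr := codeProj_trace (stab n m) m (fun i => weylBrauer n (2 ^ i))
    (fun i _ => wb_sq n _)
    (fun i hi => by
      have := stab_sc n m i hm h4 hi (2 ^ i) (hpow i hi)
      unfold Sc at this
      simp [bsgn] at this
      rw [this, neg_neg])
    (fun i hi j hj hij => by
      have := stab_sc n m j hm h4 hj (2 ^ i) (hpow i hi)
      unfold Sc at this
      rw [Nat.testBit_two_pow_of_ne hij] at this
      simp [bsgn] at this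
      exact this.symm)
  refine ⟨codeProj (stab n m) m, h1, h2, ?_, ?_⟩
  · rw [← rank_of_proj _ h2] at htr
    simp only [Fintype.card_pi, Fintype.card_fin, Finset.prod_const, Finset.card_univ] at htr
    have h5 : (codeProj (stab n m) m).rank * 2 ^ m = 2 ^ n := by exact_mod_cast htr
    have h6 : 2 ^ n = 2 ^ (n - m) * 2 ^ m := by rw [← pow_add]; congr 1; omega
    rw [h6] at h5
    exact Nat.eq_of_mul_eq_mul_right (by positivity) h5
  · intro x hx1 hx2
    obtain ⟨j, hj, hs⟩ := exists_bit n m (by omega) x hx1 hx2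
    have hG := gamma_sc n (stab n m j) (fun k => bsgn (k.testBit j))
      (fun k hk hk' => stab_sc n m j hm h4 hj k ⟨hk, hk'⟩) x
    rw [hs] at hG
    unfold Sc at hG
    have hc : Commute (stab n m j) (codeProj (stab n m) m) :=
      codeProj_comm _ _ _ fun i hi => stab_comm n m j i hm h4 hj hi
    have hP := h3 j hj
    have hP' : stab n m j * codeProj (stab n m) m = codeProj (stab n m) m := by
      rw [hc.eq, hP]
    generalize codeProj (stab n m) m = P at *
    generalize gammaOp n (2 * n + 1) x = G at *
    generalize stab n m j = g at *
    have : P * G * P = - (P * G * P) := by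
      calc P * G * P = (P * g) * G * P := by rw [hP]
        _ = P * (g * G) * P := by rw [mul_assoc P]
        _ = - (P * G * (g * P)) := by rw [hG]; simp [mul_assoc]
        _ = _ := by rw [hP']
    ext a b
    have h7 := congrFun (congrFun this a) b
    rw [Matrix.neg_apply] at h7
    exact self_eq_neg.1 h7

/-- Clifford Hamming codes: for every `s ≥ 3`, with `n = 2^s − 1`, there is an
orthogonal projection `P` on `(ℂ²)^{⊗n}` of rank `2^{2^s − s − 2}` such that
`P Γ_x P = 0` for every `x ∈ F₂^{2n+1}` with `1 ≤ wt(x) ≤ 2`; that is, a pure quantum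
code of dimension `2^{2^s − s − 2}` of even and odd Clifford minimum distance at
least `3`. -/
theorem clifford_hamming_code (s : ℕ) (hs : 3 ≤ s) :
    ∃ P : Matrix (Fin (2 ^ s - 1) → Fin 2) (Fin (2 ^ s - 1) → Fin 2) ℂ,
      Pᴴ = P ∧ P * P = P ∧ P.rank = 2 ^ (2 ^ s - s - 2) ∧
      ∀ x : Fin (2 * (2 ^ s - 1) + 1) → ZMod 2, 1 ≤ wtZ x → wtZ x ≤ 2 →
        P * gammaOp (2 ^ s - 1) (2 * (2 ^ s - 1) + 1) x * P = 0 := by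
  have h8 : s + 5 ≤ 2 ^ s := by
    obtain ⟨r, rfl⟩ : ∃ r, s = r + 3 := ⟨s - 3, by omega⟩
    have := Nat.lt_two_pow_self (n := r)
    rw [pow_add]; omega
  have := main_aux (2 ^ s - 1) (s + 1) (by rw [pow_succ]; omega) (by omega) (by omega)
  rwa [show 2 ^ s - 1 - (s + 1) = 2 ^ s - s - 2 by omega] at this

end
end

section
/- Let r ≥ 1 be an integer, let D > 0 and K > 0 be real numbers, let W : {0, 1, …, r} → ℝ, and set m = min_{0 ≤ j ≤ r} W(j). Assume W(0) > m and W(1) > m. Suppose A_0, A_1, …, A_r are nonnegative real numbers satisfying A_0 = K, ∑_{j=0}^r A_j = D, and K · ∑_{j=0}^r W(j) A_j = A_1. Then K ≤ max( −m·D/(W(0) − m), 1/(W(1) − m) ). -/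
/-- Abstract distance-2 linear programming bound: let `m = min_j W(j)` with
`W(0) > m` and `W(1) > m`.  If nonnegative reals `A_0, …, A_r` satisfy `A_0 = K`,
`∑ A_j = D`, and `K ∑ W(j) A_j = A_1`, then
`K ≤ max(−mD/(W(0) − m), 1/(W(1) − m))`. -/
theorem distance_two_bound (r : ℕ) (hr : 1 ≤ r) (D K : ℝ) (hD : 0 < D) (hK : 0 < K)
    (W : Fin (r + 1) → ℝ) (m : ℝ)
    (hm : ∀ j, m ≤ W j) (hm' : ∃ j, W j = m)
    (hW0 : m < W 0) (hW1 : m < W 1)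
    (A : Fin (r + 1) → ℝ) (hA : ∀ j, 0 ≤ A j) (hA0 : A 0 = K)
    (hsum : ∑ j, A j = D) (hlin : K * ∑ j, W j * A j = A 1) :
    K ≤ max (-m * D / (W 0 - m)) (1 / (W 1 - m)) := by
  by_cases h : K ≤ 1 / (W 1 - m)
  · exact le_max_of_le_right h
  apply le_max_of_le_left
  have h0 : 0 < W 0 - m := sub_pos.mpr hW0
  have h1 : 0 < W 1 - m := sub_pos.mpr hW1
  rw [not_le, div_lt_iff₀ h1] at h
  rw [le_div_iff₀ h0]
  have hne : (0 : Fin (r + 1)) ≠ 1 := by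
    intro e
    have := congrArg Fin.val e
    rw [Fin.val_one', Nat.mod_eq_of_lt (by omega)] at this
    simp at this
  have key : ∑ j ∈ ({0, 1} : Finset (Fin (r + 1))), (W j - m) * A j
      ≤ ∑ j, (W j - m) * A j :=
    Finset.sum_le_sum_of_subset_of_nonneg (Finset.subset_univ _)
      (fun j _ _ => mul_nonneg (sub_nonneg.mpr (hm j)) (hA j))
  rw [Finset.sum_pair hne] at key
  simp only [sub_mul, Finset.sum_sub_distrib, ← Finset.mul_sum] at key
  rw [hsum, hA0, ← hlin] at key
  have hS : 0 ≤ ∑ j, W j * A j := by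
    have := hA 1
    rw [← hlin] at this
    exact nonneg_of_mul_nonneg_right this hK
  nlinarith [mul_nonneg hS (sub_nonneg.mpr h.le)]
end

section
/- Let r ≥ 1 be an integer, let D > 0 and K > 0 be real numbers, let W : {0, 1, …, r} → ℝ, and set m = min_{0 ≤ j ≤ r} W(j). Assume W(0) > m. Suppose A_0, A_1, …, A_r are nonnegative real numbers satisfying A_0 = K, A_1 = 0, ∑_{j=0}^r A_j = D, and K · ∑_{j=0}^r W(j) A_j = A_1. Then K ≤ −m·D/(W(0) − m). -/
/-- Abstract distance-2 linear programming bound for pure codes: let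
`m = min_j W(j)` with `W(0) > m`.  If nonnegative reals `A_0, …, A_r` satisfy
`A_0 = K`, `A_1 = 0`, `∑ A_j = D`, and `K ∑ W(j) A_j = A_1`, then
`K ≤ −mD/(W(0) − m)`. -/
theorem pure_distance_two_bound (r : ℕ) (hr : 1 ≤ r) (D K : ℝ) (hD : 0 < D)
    (hK : 0 < K) (W : Fin (r + 1) → ℝ) (m : ℝ)
    (hm : ∀ j, m ≤ W j) (hm' : ∃ j, W j = m) (hW0 : m < W 0)
    (A : Fin (r + 1) → ℝ) (hA : ∀ j, 0 ≤ A j) (hA0 : A 0 = K) (hA1 : A 1 = 0)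
    (hsum : ∑ j, A j = D) (hlin : K * ∑ j, W j * A j = A 1) :
    K ≤ -m * D / (W 0 - m) := by
  have hz : ∑ j, W j * A j = 0 := by
    rw [hA1] at hlin
    exact (mul_eq_zero.mp hlin).resolve_left hK.ne'
  have h1 : (W 0 - m) * A 0 ≤ ∑ j, (W j - m) * A j :=
    Finset.single_le_sum (f := fun j => (W j - m) * A j)
      (fun j _ => mul_nonneg (sub_nonneg.mpr (hm j)) (hA j)) (Finset.mem_univ 0)
  have h2 : ∑ j, (W j - m) * A j = -m * D := by
    simp only [sub_mul, Finset.sum_sub_distrib, ← Finset.mul_sum, hz, hsum]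
    ring
  rw [le_div_iff₀ (sub_pos.mpr hW0)]
  rw [h2, hA0] at h1
  linarith
end

section
/- Let q ≥ 2 and n ≥ 2, and let H = (ℂ^q)^{⊗n}. Suppose P is a nonzero orthogonal projection on H such that for every 1 ≤ k ≤ n and every q × q complex matrix A there exists ε ∈ ℂ with P (I_q^{⊗(k−1)} ⊗ A ⊗ I_q^{⊗(n−k)}) P = ε P. Then rank P ≤ q^{n−2}. -/
noncomputable section

open Matrix

/-- The one-site error `I_q^{⊗(k−1)} ⊗ A ⊗ I_q^{⊗(n−k)}` on `(ℂ^q)^{⊗n}`, acting as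
the `q × q` matrix `A` on the `k`-th tensor factor and trivially elsewhere. -/
def siteOp (q n : ℕ) (k : Fin n) (A : Matrix (Fin q) (Fin q) ℂ) :
    Matrix (Fin n → Fin q) (Fin n → Fin q) ℂ :=
  Matrix.of fun a b =>
    A (a k) (b k) * ∏ i ∈ Finset.univ.erase k, (if a i = b i then (1 : ℂ) else 0)

section Aux

open scoped Kronecker ComplexOrder

/-- Rank normal form: a section and a retraction of a square matrix. -/
lemma qh_exists_LR {m : Type*} [Fintype m] [DecidableEq m] (M : Matrix m m ℂ) :
    ∃ (L : Matrix (Fin M.rank) m ℂ) (R : Matrix m (Fin M.rank) ℂ),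
      L * M * R = 1 ∧ M * (R * L * M) = M := by
  obtain ⟨V, U, e, hV, hU, h⟩ := M.exists_rank_normal_form
  set D : Matrix m m ℂ := (fromBlocks 1 0 0 0).submatrix e e with hD
  let J : Matrix (Fin M.rank) m ℂ := of fun a x => if e x = Sum.inl a then 1 else 0
  have h1 : Jᵀ * J = D := by
    ext x y
    simp only [mul_apply, transpose_apply, J, of_apply, hD, submatrix_apply]
    rcases hx : e x with a | a <;> rcases hy : e y with b | b <;>
      simp [Matrix.one_apply, eq_comm]
  have h2 : J * Jᵀ = 1 := by
    ext a b
    simp only [mul_apply, transpose_apply, J, of_apply]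
    rw [← e.symm.sum_comp]
    simp [Matrix.one_apply, eq_comm]
  have h3 : D * D = D := by
    rw [← h1]
    calc Jᵀ * J * (Jᵀ * J) = Jᵀ * (J * Jᵀ) * J := by simp only [Matrix.mul_assoc]
      _ = _ := by rw [h2, Matrix.mul_one]
  refine ⟨J * V, U * Jᵀ, ?_, ?_⟩
  · calc J * V * M * (U * Jᵀ) = J * (V * M * U) * Jᵀ := by simp only [Matrix.mul_assoc]
      _ = (J * Jᵀ) * (J * Jᵀ) := by rw [h, ← h1]; simp only [Matrix.mul_assoc]
      _ = 1 := by rw [h2, Matrix.mul_one]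
  · apply hV.mul_left_cancel
    apply hU.mul_right_cancel
    calc V * (M * (U * Jᵀ * (J * V) * M)) * U = (V * M * U) * (Jᵀ * J) * (V * M * U) := by
          simp only [Matrix.mul_assoc]
      _ = V * M * U := by rw [h, h1, h3, h3]

lemma qh_rank_kronecker_ge {m n : Type*} [Fintype m] [DecidableEq m] [Fintype n] [DecidableEq n]
    (A : Matrix m m ℂ) (B : Matrix n n ℂ) : A.rank * B.rank ≤ (A ⊗ₖ B).rank := by
  obtain ⟨L, R, h, -⟩ := qh_exists_LR A
  obtain ⟨L', R', h', -⟩ := qh_exists_LR B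
  have key : (L ⊗ₖ L') * (A ⊗ₖ B) * (R ⊗ₖ R') = 1 := by
    rw [← mul_kronecker_mul, ← mul_kronecker_mul, h, h', one_kronecker_one]
  have h1 : (1 : Matrix (Fin A.rank × Fin B.rank) (Fin A.rank × Fin B.rank) ℂ).rank
      = A.rank * B.rank := by
    rw [rank_one]; simp
  rw [← h1, ← key]
  exact (rank_mul_le_left _ _).trans (rank_mul_le_right _ _)

/-- The main rank inequality. -/
lemma qh_main {I J C X : Type*} [Fintype I] [Fintype J] [Fintype C] [Fintype X]
    [DecidableEq I] [DecidableEq J] [DecidableEq C] [DecidableEq X]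
    (P : Matrix X X ℂ) (e : I → J → C → X) (σ : Matrix I I ℂ) (τ : Matrix J J ℂ)
    (hσ : ∀ i i' y y', ∑ j, ∑ c, star (P (e i j c) y) * P (e i' j c) y' = σ i i' * P y y')
    (hτ : ∀ j j' y y', ∑ i, ∑ c, star (P (e i j c) y) * P (e i j' c) y' = τ j j' * P y y') :
    σ.rank * P.rank ≤ τ.rank * Fintype.card C ∧
      (σ.rank = 0 → ∀ i j c y, P (e i j c) y = 0) := by
  let MA : Matrix (J × C) (I × X) ℂ := of fun a b => P (e b.1 a.1 a.2) b.2
  let MB : Matrix (I × C) (J × X) ℂ := of fun a b => P (e a.1 b.1 a.2) b.2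
  have hA : MAᴴ * MA = σ ⊗ₖ P := by
    ext ⟨i, y⟩ ⟨i', y'⟩
    simp only [mul_apply, conjTranspose_apply, MA, of_apply, kroneckerMap_apply,
      Fintype.sum_prod_type, hσ]
  have hB : MBᴴ * MB = τ ⊗ₖ P := by
    ext ⟨i, y⟩ ⟨i', y'⟩
    simp only [mul_apply, conjTranspose_apply, MB, of_apply, kroneckerMap_apply,
      Fintype.sum_prod_type, hτ]
  constructor
  · obtain ⟨L, R, -, h⟩ := qh_exists_LR τ
    have h0 : MB * ((1 - R * L * τ) ⊗ₖ (1 : Matrix X X ℂ)) = 0 := by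
      rw [← conjTranspose_mul_self_mul_eq_zero, hB, ← mul_kronecker_mul, Matrix.mul_sub, h]
      simp
    have h1 : ((R * L * τ)ᵀ ⊗ₖ (1 : Matrix C C ℂ)) * MA = MA := by
      clear h
      generalize R * L * τ = T at h0 ⊢
      ext ⟨j, c⟩ ⟨i, y⟩
      have := congrFun (congrFun h0 (i, c)) (j, y)
      simp only [mul_apply, Fintype.sum_prod_type, kroneckerMap_apply, MB, of_apply,
        Matrix.sub_apply, Matrix.zero_apply, sub_mul, mul_sub, Finset.sum_sub_distrib] at this
      rw [mul_apply]
      simp [Fintype.sum_prod_type, MA, Matrix.one_apply] at this ⊢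
      rw [sub_eq_zero] at this
      rw [this]
      exact Finset.sum_congr rfl fun _ _ => mul_comm _ _
    have h2 : (R * L * τ)ᵀ ⊗ₖ (1 : Matrix C C ℂ)
        = ((L * τ)ᵀ ⊗ₖ (1 : Matrix C C ℂ)) * (Rᵀ ⊗ₖ (1 : Matrix C C ℂ)) := by
      rw [← mul_kronecker_mul, Matrix.mul_one, ← transpose_mul, Matrix.mul_assoc]
    calc σ.rank * P.rank ≤ (σ ⊗ₖ P).rank := qh_rank_kronecker_ge _ _
      _ = MA.rank := by rw [← hA, rank_conjTranspose_mul_self]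
      _ ≤ ((L * τ)ᵀ ⊗ₖ (1 : Matrix C C ℂ)).rank := by
        rw [← h1, h2]
        exact (rank_mul_le_left _ _).trans (rank_mul_le_left _ _)
      _ ≤ Fintype.card (Fin τ.rank × C) := rank_le_card_width _
      _ = _ := by simp
  · intro h0 i j c y
    obtain ⟨L, R, -, h⟩ := qh_exists_LR σ
    have hs : σ = 0 := by
      rw [← h]
      have : IsEmpty (Fin σ.rank) := by rw [h0]; infer_instance
      have : R * L = 0 := by ext; simp [mul_apply]
      rw [this]; simp
    rw [hs] at hA
    have : MA = 0 := by
      rw [← conjTranspose_mul_self_eq_zero, hA]; simp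
    exact congrFun (congrFun this (j, c)) (i, y)

end Aux

lemma qh_e_bij (q m : ℕ) (f : (Fin (m + 2) → Fin q) → ℂ) :
    ∑ x, f x = ∑ i, ∑ j, ∑ c : Fin m → Fin q,
      f (Fin.cons i (Fin.cons j c : Fin (m + 1) → Fin q) : Fin (m + 2) → Fin q) := by
  rw [← (Fin.consEquiv (fun _ : Fin (m + 2) => Fin q)).sum_comp, Fintype.sum_prod_type]
  refine Finset.sum_congr rfl fun i _ => ?_
  rw [← (Fin.consEquiv (fun _ : Fin (m + 1) => Fin q)).sum_comp, Fintype.sum_prod_type]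
  rfl

lemma qh_site0 (q m : ℕ) (i₀ i₁ i i' j j' : Fin q) (c c' : Fin m → Fin q) :
    siteOp q (m + 2) 0 (Matrix.single i₀ i₁ 1)
      (Fin.cons i (Fin.cons j c : Fin (m + 1) → Fin q) : Fin (m + 2) → Fin q)
      (Fin.cons i' (Fin.cons j' c' : Fin (m + 1) → Fin q) : Fin (m + 2) → Fin q)
    = if i₀ = i then if i₁ = i' then if j = j' then if c = c' then 1 else 0 else 0 else 0 else 0 := by
  simp only [siteOp, of_apply, Finset.prod_boole, Fin.cons_zero, Matrix.single_apply]
  have : (∀ k ∈ Finset.univ.erase (0 : Fin (m + 2)),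
      (Fin.cons i (Fin.cons j c : Fin (m + 1) → Fin q) : Fin (m + 2) → Fin q) k
      = (Fin.cons i' (Fin.cons j' c' : Fin (m + 1) → Fin q) : Fin (m + 2) → Fin q) k)
      ↔ j = j' ∧ c = c' := by
    simp [Fin.forall_fin_succ (n := m + 1), Fin.forall_fin_succ (n := m), funext_iff]
  simp only [this]
  split_ifs <;> simp_all

lemma qh_site1 (q m : ℕ) (j₀ j₁ i i' j j' : Fin q) (c c' : Fin m → Fin q) :
    siteOp q (m + 2) 1 (Matrix.single j₀ j₁ 1)
      (Fin.cons i (Fin.cons j c : Fin (m + 1) → Fin q) : Fin (m + 2) → Fin q)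
      (Fin.cons i' (Fin.cons j' c' : Fin (m + 1) → Fin q) : Fin (m + 2) → Fin q)
    = if j₀ = j then if j₁ = j' then if i = i' then if c = c' then 1 else 0 else 0 else 0 else 0 := by
  have h1 : ∀ (a b : Fin q) (d : Fin m → Fin q),
      (Fin.cons a (Fin.cons b d : Fin (m + 1) → Fin q) : Fin (m + 2) → Fin q) 1 = b :=
    fun a b d => rfl
  simp only [siteOp, of_apply, Finset.prod_boole, h1, Matrix.single_apply]
  have : (∀ k ∈ Finset.univ.erase (1 : Fin (m + 2)),
      (Fin.cons i (Fin.cons j c : Fin (m + 1) → Fin q) : Fin (m + 2) → Fin q) k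
      = (Fin.cons i' (Fin.cons j' c' : Fin (m + 1) → Fin q) : Fin (m + 2) → Fin q) k)
      ↔ i = i' ∧ c = c' := by
    have h2 : ∀ k : Fin m, k.succ.succ ≠ (1 : Fin (m + 2)) := fun k h => by
      simpa [Fin.ext_iff] using h
    simp [Fin.forall_fin_succ (n := m + 1), Fin.forall_fin_succ (n := m), funext_iff, h2]
  simp only [this]
  split_ifs <;> simp_all

/-- Distance-2 bound for `q`-ary quantum Hamming space: if a nonzero orthogonal
projection `P` on `(ℂ^q)^{⊗n}` detects every one-site error, then
`rank P ≤ q^{n−2}`. -/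
theorem quantum_hamming_distance_two_bound (q n : ℕ) (hq : 2 ≤ q) (hn : 2 ≤ n)
    (P : Matrix (Fin n → Fin q) (Fin n → Fin q) ℂ)
    (hPherm : Pᴴ = P) (hPidem : P * P = P) (hPne : P ≠ 0)
    (hdet : ∀ (k : Fin n) (A : Matrix (Fin q) (Fin q) ℂ),
      ∃ ε : ℂ, P * siteOp q n k A * P = ε • P) :
    P.rank ≤ q ^ (n - 2) := by
  obtain ⟨m, rfl⟩ : ∃ m, n = m + 2 := ⟨n - 2, by omega⟩
  choose ε hε using hdet
  let e : Fin q → Fin q → (Fin m → Fin q) → (Fin (m + 2) → Fin q) := fun i j c =>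
    (Fin.cons i (Fin.cons j c : Fin (m + 1) → Fin q) : Fin (m + 2) → Fin q)
  have hst : ∀ x y, star (P x y) = P y x := fun x y => by
    rw [← conjTranspose_apply, hPherm]
  let σ : Matrix (Fin q) (Fin q) ℂ := of fun i i' => ε 0 (Matrix.single i i' 1)
  let τ : Matrix (Fin q) (Fin q) ℂ := of fun i i' => ε 1 (Matrix.single i i' 1)
  have hσ : ∀ i i' y y', ∑ j, ∑ c, star (P (e i j c) y) * P (e i' j c) y' = σ i i' * P y y' := by
    intro i i' y y'
    have := congrFun (congrFun (hε 0 (Matrix.single i i' 1)) y) y'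
    simp only [Matrix.smul_apply, smul_eq_mul] at this
    simp only [σ, of_apply]
    rw [← this]
    simp only [mul_apply, qh_e_bij, qh_site0, hst, e]
    simp [Finset.sum_mul, Finset.sum_ite_irrel]
  have hτ : ∀ j j' y y', ∑ i, ∑ c, star (P (e i j c) y) * P (e i j' c) y' = τ j j' * P y y' := by
    intro i i' y y'
    have := congrFun (congrFun (hε 1 (Matrix.single i i' 1)) y) y'
    simp only [Matrix.smul_apply, smul_eq_mul] at this
    simp only [τ, of_apply]
    rw [← this]
    simp only [mul_apply, qh_e_bij, qh_site1, hst, e]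
    simp [Finset.sum_mul, Finset.sum_ite_irrel]
  have hsurj : ∀ x, ∃ i j c, e i j c = x := fun x =>
    ⟨x 0, Fin.tail x 0, Fin.tail (Fin.tail x), by simp [e]⟩
  have hne : ¬ ∀ i j c y, P (e i j c) y = 0 := by
    intro h
    apply hPne
    ext x y
    obtain ⟨i, j, c, rfl⟩ := hsurj x
    exact h i j c y
  obtain ⟨a1, a2⟩ := qh_main P e σ τ hσ hτ
  obtain ⟨b1, b2⟩ := qh_main P (fun j i c => e i j c) τ σ hτ hσ
  have hs : 0 < σ.rank := Nat.pos_of_ne_zero fun h => hne (a2 h)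
  have ht : 0 < τ.rank := Nat.pos_of_ne_zero fun h => hne fun i j c y => b2 h j i c y
  have hC : Fintype.card (Fin m → Fin q) = q ^ (m + 2 - 2) := by simp
  rw [hC] at a1 b1
  rcases le_total τ.rank σ.rank with h | h
  · exact Nat.le_of_mul_le_mul_left (a1.trans (Nat.mul_le_mul_right _ h)) hs
  · exact Nat.le_of_mul_le_mul_left (b1.trans (Nat.mul_le_mul_right _ h)) ht

end
end

section
/- Let n ≥ 1. Suppose P is a nonzero orthogonal projection on (ℂ²)^{⊗n} such that for every x ∈ F₂^{2n} with wt(x) = 1 there exists ε ∈ ℂ with P Γ_x P = ε P (i.e., P is an even Clifford code of minimum distance at least 2). Then rank P ≤ 2^{n−1}. -/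
noncomputable section

open Matrix

/-- Tensor products of single-site matrices. -/
def tensM {n : ℕ} (M : Fin n → Matrix (Fin 2) (Fin 2) ℂ) :
    Matrix (Fin n → Fin 2) (Fin n → Fin 2) ℂ :=
  Matrix.of fun a b => ∏ i : Fin n, M i (a i) (b i)

lemma tensM_mul {n : ℕ} (M N : Fin n → Matrix (Fin 2) (Fin 2) ℂ) :
    tensM M * tensM N = tensM (fun i => M i * N i) := by
  ext a b
  simp only [tensM, Matrix.mul_apply, Matrix.of_apply]
  rw [Finset.prod_univ_sum]
  simp [Finset.prod_mul_distrib]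

lemma tensM_one {n : ℕ} : tensM (fun _ : Fin n => (1 : Matrix (Fin 2) (Fin 2) ℂ)) = 1 := by
  ext a b
  simp only [tensM, Matrix.of_apply]
  by_cases h : a = b
  · subst h; simp
  · obtain ⟨i, hi⟩ := Function.ne_iff.mp h
    rw [Matrix.one_apply_ne h]
    exact Finset.prod_eq_zero (Finset.mem_univ i) (Matrix.one_apply_ne hi)

lemma wb_one_eq (m : ℕ) : weylBrauer (m + 1) 1 =
    tensM (fun i : Fin (m + 1) => if i = 0 then pauliX else 1) := by
  ext a b
  simp only [weylBrauer, tensM, Matrix.of_apply]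
  refine Finset.prod_congr rfl fun i _ => ?_
  have : ((i : ℕ) = 0) ↔ i = 0 := by rw [Fin.ext_iff]; rfl
  simp [wbFactor, this]

lemma wb_sq_s14 (m : ℕ) : weylBrauer (m + 1) 1 * weylBrauer (m + 1) 1 = 1 := by
  rw [wb_one_eq, tensM_mul, ← tensM_one]
  congr 1
  funext i
  by_cases h : i = 0
  · simp [h, pauliX, Matrix.one_fin_two]
  · simp [h]

lemma wb_herm_s14 (m : ℕ) : (weylBrauer (m + 1) 1)ᴴ = weylBrauer (m + 1) 1 := by
  rw [wb_one_eq]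
  ext a b
  simp only [tensM, Matrix.conjTranspose_apply, Matrix.of_apply, star_prod]
  refine Finset.prod_congr rfl fun i _ => ?_
  by_cases h : i = 0
  · simp only [h, if_true]
    generalize a 0 = p
    generalize b 0 = q
    fin_cases p <;> fin_cases q <;> simp [pauliX]
  · simp [h, Matrix.one_apply, eq_comm, apply_ite]

/-- The sign matrix on the first site. -/
def signV (m : ℕ) : Matrix (Fin (m + 1) → Fin 2) (Fin (m + 1) → Fin 2) ℂ :=
  Matrix.diagonal fun a => if a 0 = 0 then 1 else -1

lemma signV_sq (m : ℕ) : signV m * signV m = 1 := by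
  rw [signV, Matrix.diagonal_mul_diagonal, ← Matrix.diagonal_one]
  congr 1
  funext a
  split_ifs <;> simp

lemma wb_anti_s14 (m : ℕ) : weylBrauer (m + 1) 1 * signV m = -(signV m * weylBrauer (m + 1) 1) := by
  ext a b
  rw [Matrix.neg_apply, signV, Matrix.mul_diagonal, Matrix.diagonal_mul, wb_one_eq, tensM,
    Matrix.of_apply, Fin.prod_univ_succ]
  simp only [if_true]
  generalize a 0 = p
  generalize b 0 = q
  fin_cases p <;> fin_cases q <;> simp [pauliX]

lemma gamma_single (m : ℕ) :
    gammaOp (m + 1) (2 * (m + 1)) (Pi.single ⟨0, by omega⟩ 1) = weylBrauer (m + 1) 1 ∧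
    wtZ (Pi.single (⟨0, by omega⟩ : Fin (2 * (m + 1))) (1 : ZMod 2)) = 1 := by
  have hw : wtZ (Pi.single (⟨0, by omega⟩ : Fin (2 * (m + 1))) (1 : ZMod 2)) = 1 := by
    rw [wtZ, Finset.card_eq_one]
    refine ⟨⟨0, by omega⟩, ?_⟩
    ext i
    by_cases h : i = ⟨0, by omega⟩
    · subst h
      simp only [Finset.mem_filter, Finset.mem_univ, true_and, Finset.mem_singleton]
      rw [Pi.single_eq_same]
      exact ⟨fun _ => trivial, fun _ => one_ne_zero⟩
    · simp only [Finset.mem_filter, Finset.mem_univ, true_and, Finset.mem_singleton]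
      rw [Pi.single_eq_of_ne h]
      exact ⟨fun hh => absurd rfl hh, fun hh => absurd hh h⟩
  refine ⟨?_, hw⟩
  have hx0 : xcomp (Pi.single (⟨0, by omega⟩ : Fin (2 * (m + 1))) (1 : ZMod 2)) 0 = 1 := by
    rw [xcomp, dif_pos (by omega), Pi.single_eq_same]
    rfl
  have hx : ∀ k, k ≠ 0 →
      xcomp (Pi.single (⟨0, by omega⟩ : Fin (2 * (m + 1))) (1 : ZMod 2)) k = 0 := by
    intro k hk
    rw [xcomp]
    split_ifs with h
    · rw [Pi.single_eq_of_ne (by simpa [Fin.ext_iff] using hk)]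
      rfl
    · rfl
  rw [gammaOp, tauZ, hw, hx (2 * (m + 1)) (by omega), List.finRange_succ]
  simp only [List.bind_eq_flatMap, List.pure_def, List.flatMap_cons, List.singleton_append,
    List.map_cons, List.prod_cons, Fin.val_zero, hx0]
  rw [hx (m + 1 + 0) (by omega), List.prod_eq_one]
  · simp
  · intro y hy
    rw [List.mem_map] at hy
    obtain ⟨k, hk, rfl⟩ := hy
    have hk0 : k ≠ 0 := by
      rintro rfl
      simp at hk
      obtain ⟨a, ha, h0⟩ := hk
      exact ha (Fin.ext h0.symm)
    rw [hx _ hk0, hx _ (by omega)]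
    simp

lemma rank_bound {ι : Type*} [Fintype ι] [DecidableEq ι] (P W W' : Matrix ι ι ℂ)
    (hW : W' * W = 1) (h : P * W * P = 0) : 2 * P.rank ≤ Fintype.card ι := by
  have h1 : P.rank ≤ (W * P).rank := by
    have := Matrix.rank_mul_le_right W' (W * P)
    rwa [← Matrix.mul_assoc, hW, Matrix.one_mul] at this
  have hle : LinearMap.range (W * P).mulVecLin ≤ LinearMap.ker P.mulVecLin := by
    rintro _ ⟨v, rfl⟩
    simp [Matrix.mulVec_mulVec, ← Matrix.mul_assoc, h]
  have h2 := Submodule.finrank_mono hle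
  have h3 := LinearMap.finrank_range_add_finrank_ker P.mulVecLin
  rw [Module.finrank_fintype_fun_eq_card] at h3
  unfold Matrix.rank at *
  omega

open scoped ComplexOrder in
lemma abstract_bound {ι : Type*} [Fintype ι] [DecidableEq ι] (P U V : Matrix ι ι ℂ)
    (hP : Pᴴ = P) (hPP : P * P = P) (hU : Uᴴ = U) (hUU : U * U = 1) (hVV : V * V = 1)
    (hUV : U * V = -(V * U)) (ε : ℂ) (h : P * U * P = ε • P) :
    2 * P.rank ≤ Fintype.card ι := by
  by_cases he : ε * ε = 1
  · have hstar : star ε = ε := by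
      rcases mul_self_eq_one_iff.mp he with h | h <;> simp [h]
    have hz : U * P - ε • P = 0 := by
      rw [← Matrix.conjTranspose_mul_self_eq_zero]
      simp only [Matrix.conjTranspose_sub, Matrix.conjTranspose_mul, Matrix.conjTranspose_smul,
        hP, hU, hstar]
      have e1 : P * U * (U * P) = P := by
        rw [Matrix.mul_assoc, ← Matrix.mul_assoc U, hUU, Matrix.one_mul, hPP]
      have e2 : P * (U * P) = ε • P := by rw [← Matrix.mul_assoc, h]
      simp only [sub_mul, mul_sub, Matrix.smul_mul, Matrix.mul_smul, e1, e2, h, hPP, smul_smul, he]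
      simp
    have hUP : U * P = ε • P := sub_eq_zero.mp hz
    have hPU : P * U = ε • P := by
      have := congrArg Matrix.conjTranspose hUP
      simpa [Matrix.conjTranspose_mul, Matrix.conjTranspose_smul, hP, hU, hstar] using this
    refine rank_bound P V V hVV ?_
    have e1 : P * U * V * P = ε • (P * V * P) := by
      rw [hPU]; simp
    have e2 : P * U * V * P = -(ε • (P * V * P)) := by
      rw [Matrix.mul_assoc P U V, hUV]
      simp only [Matrix.mul_neg, Matrix.neg_mul]
      rw [← Matrix.mul_assoc P V U, Matrix.mul_assoc _ U P, hUP, Matrix.mul_smul]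
    have e3 : ε • (P * V * P) = 0 := by
      have e4 := e1.symm.trans e2
      ext i j
      have e5 := congrFun (congrFun e4 i) j
      rw [Matrix.neg_apply] at e5
      exact self_eq_neg.mp e5
    have hne : ε ≠ 0 := by rintro rfl; simp at he
    exact (smul_eq_zero.mp e3).resolve_left hne
  · have hne : 1 - ε * ε ≠ 0 := fun h => he (sub_eq_zero.mp h).symm
    refine rank_bound P (U - ε • 1) ((1 - ε * ε)⁻¹ • (U + ε • 1)) ?_ ?_
    · have : (U + ε • 1) * (U - ε • 1) = (1 - ε * ε) • (1 : Matrix ι ι ℂ) := by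
        simp only [add_mul, mul_sub, hUU, Matrix.smul_mul, Matrix.mul_smul, Matrix.one_mul,
          Matrix.mul_one, smul_smul, sub_smul, one_smul]
        abel
      rw [Matrix.smul_mul, this, smul_smul, inv_mul_cancel₀ hne, one_smul]
    · simp [mul_sub, sub_mul, h, hPP]

/-- Distance-2 bound for the even Clifford quantum metric: if a nonzero orthogonal
projection `P` on `(ℂ²)^{⊗n}` detects every `Γ_x` with `x ∈ F₂^{2n}` of weight `1`,
then `rank P ≤ 2^{n−1}`. -/
theorem cl_even_distance_two_bound (n : ℕ) (hn : 1 ≤ n)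
    (P : Matrix (Fin n → Fin 2) (Fin n → Fin 2) ℂ)
    (hPherm : Pᴴ = P) (hPidem : P * P = P) (hPne : P ≠ 0)
    (hdet : ∀ x : Fin (2 * n) → ZMod 2, wtZ x = 1 →
      ∃ ε : ℂ, P * gammaOp n (2 * n) x * P = ε • P) :
    P.rank ≤ 2 ^ (n - 1) := by
  obtain ⟨m, rfl⟩ : ∃ m, n = m + 1 := ⟨n - 1, by omega⟩
  obtain ⟨hg, hw⟩ := gamma_single m
  obtain ⟨ε, hε⟩ := hdet _ hw
  rw [hg] at hε
  have := abstract_bound P _ (signV m) hPherm hPidem (wb_herm_s14 m) (wb_sq_s14 m) (signV_sq m)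
    (wb_anti_s14 m) ε hε
  simp only [Fintype.card_fun, Fintype.card_fin, pow_succ] at this
  simp only [Nat.add_sub_cancel]
  omega

end
end
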